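/- arXiv:1606.02994 — 4 statements merged into one kernel-verified Lean document; each statement's English description precedes it below -/
import Mathlib

section
/- Consider a birth and death process whose birth rate satisfies η(x) ≤ C(1+x) for all x∈ℕ and some C>0, whose Wasserstein curvature κ is finite (κ>−∞), and such that Lip(η)+Lip(ν)<∞. Let ρ∈(1,2] and let {P_t}, {P̃_t} be the time marginals of two such processes with the same generator and initial laws P₀, P̃₀ on ℕ having finite ρ-moments. Then for all t≥0, W_ρ^ρ(P_t,P̃_t) ≤ W_ρ^ρ(P₀,P̃₀) e^{−κρt} + (Lip(η)+Lip(ν)) W₁(P₀,P̃₀) (e^{−κt}−e^{−κρt})/(κ(ρ−1)), where for κ=0 the fraction (e^{−κt}−e^{−κρt})/κ is interpreted as its limit t(ρ−1). -/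
open MeasureTheory

/-- `π` is a coupling of `P` and `Q`. -/
def IsCoupling {E : Type*} [MeasurableSpace E] (π : Measure (E × E)) (P Q : Measure E) : Prop :=
  π.map Prod.fst = P ∧ π.map Prod.snd = Q

/-- `wassersteinPow ρ P Q = W_ρ^ρ(P, Q)`. -/
noncomputable def wassersteinPow {E : Type*} [MeasurableSpace E] [NormedAddCommGroup E]
    (ρ : ℝ) (P Q : Measure E) : ℝ :=
  sInf {c : ℝ | ∃ π : Measure (E × E), IsCoupling π P Q ∧ c = ∫ p, ‖p.1 - p.2‖ ^ ρ ∂π}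

/-- `p : ℝ → ℕ → ℝ` is the family of time marginals (probability mass functions on `ℕ`)
of a birth and death process with birth rate `η` and death rate `ν`, i.e. a solution of
the Kolmogorov forward equations. -/
def IsBDMarginal (η ν : ℕ → ℝ) (p : ℝ → ℕ → ℝ) : Prop :=
  (∀ t : ℝ, 0 ≤ t → (∀ x, 0 ≤ p t x) ∧ HasSum (p t) 1) ∧
  (∀ x : ℕ, ∀ t : ℝ, 0 ≤ t →
    HasDerivWithinAt (fun s => p s x)
      ((if x = 0 then 0 else η (x - 1) * p t (x - 1)) + ν (x + 1) * p t (x + 1)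
        - (η x + ν x) * p t x)
      (Set.Ici 0) t)

/-- The probability measure on `ℝ` associated with a probability mass function on `ℕ`. -/
noncomputable def pmfMeasure (p : ℕ → ℝ) : Measure ℝ :=
  Measure.sum fun n => ENNReal.ofReal (p n) • Measure.dirac (n : ℝ)

/-- The Wasserstein curvature `κ = inf_x (η(x)+ν(x+1)−η(x+1)−ν(x))`. -/
noncomputable def bdKappa (η ν : ℕ → ℝ) : ℝ :=
  ⨅ x : ℕ, (η x + ν (x + 1) - η (x + 1) - ν x)

/-- `Lip(f) = sup_x |f(x+1) − f(x)|`. -/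
noncomputable def bdLip (f : ℕ → ℝ) : ℝ :=
  ⨆ x : ℕ, |f (x + 1) - f x|


lemma rpow_add_le_taylor {r a b : ℝ} (hr1 : 1 < r) (hr2 : r ≤ 2) (ha : 0 ≤ a) (hb : 0 ≤ b) :
    (a + b) ^ r ≤ a ^ r + r * a ^ (r - 1) * b + b ^ r := by
  let f : ℝ → ℝ := fun u => a ^ r + r * a ^ (r - 1) * u + u ^ r - (a + u) ^ r
  have hd : ∀ u, HasDerivAt f (r * a ^ (r - 1) + r * u ^ (r - 1) - r * (a + u) ^ (r - 1)) u := by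
    intro u
    have h1 := Real.hasDerivAt_rpow_const (x := u) (p := r) (Or.inr hr1.le)
    have h2 := (((hasDerivAt_id u).const_add a).rpow_const (p := r) (Or.inr hr1.le))
    have h3 := (((hasDerivAt_id u).const_mul (r * a ^ (r - 1))).const_add (a ^ r))
    convert! (h3.add h1).sub h2 using 1
    simp
  have hmono : MonotoneOn f (Set.Ici 0) := by
    apply monotoneOn_of_deriv_nonneg (convex_Ici 0)
    · exact fun u _ => (hd u).continuousAt.continuousWithinAt
    · exact fun u _ => (hd u).differentiableAt.differentiableWithinAt
    · intro u hu
      rw [interior_Ici, Set.mem_Ioi] at hu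
      rw [(hd u).deriv]
      have := Real.rpow_add_le_add_rpow ha hu.le (by linarith : 0 ≤ r - 1) (by linarith)
      nlinarith
  have := hmono (Set.self_mem_Ici) hb hb
  simp only [f] at this
  rw [Real.zero_rpow (by linarith)] at this
  simp only [add_zero, mul_zero, sub_self] at this
  linarith

lemma rpow_le_taylor_sub {r a b : ℝ} (hr1 : 1 < r) (hr2 : r ≤ 2) (ha : 0 ≤ a) (hb : 0 ≤ b) :
    a ^ r ≤ (a + b) ^ r - r * (a + b) ^ (r - 1) * b + b ^ r := by
  let n := a + b
  let f : ℝ → ℝ := fun u => n ^ r - r * n ^ (r - 1) * u + u ^ r - (n - u) ^ r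
  have hd : ∀ u, HasDerivAt f (- (r * n ^ (r - 1)) + r * u ^ (r - 1) + r * (n - u) ^ (r - 1)) u := by
    intro u
    have h1 := Real.hasDerivAt_rpow_const (x := u) (p := r) (Or.inr hr1.le)
    have h2 := (((hasDerivAt_id u).const_sub n).rpow_const (p := r) (Or.inr hr1.le))
    have h3 := (((hasDerivAt_id u).const_mul (r * n ^ (r - 1))).const_sub (n ^ r))
    convert! (h3.add h1).sub h2 using 1
    simp
  have hmono : MonotoneOn f (Set.Icc 0 n) := by
    apply monotoneOn_of_deriv_nonneg (convex_Icc 0 n)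
    · exact fun u _ => (hd u).continuousAt.continuousWithinAt
    · exact fun u _ => (hd u).differentiableAt.differentiableWithinAt
    · intro u hu
      rw [interior_Icc, Set.mem_Ioo] at hu
      rw [(hd u).deriv]
      have := Real.rpow_add_le_add_rpow (by linarith : 0 ≤ n - u) hu.1.le
        (by linarith : 0 ≤ r - 1) (by linarith)
      rw [sub_add_cancel] at this
      nlinarith
  have hbn : b ∈ Set.Icc 0 n := ⟨hb, by simp only [n]; linarith⟩
  have := hmono (Set.left_mem_Icc.2 (hbn.1.trans hbn.2)) hbn hb
  simp only [f, n] at this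
  rw [Real.zero_rpow (by linarith), add_sub_cancel_right] at this
  simp only [add_zero, mul_zero, sub_self, sub_zero] at this
  linarith

lemma exists_hasDerivWithinAt_max_zero {f : ℝ → ℝ} {f' t : ℝ}
    (hf : HasDerivWithinAt f f' (Set.Ici t) t) :
    ∃ e : ℝ, (e = 0 ∧ f t ≤ 0 ∨ e = 1 ∧ 0 ≤ f t) ∧
      HasDerivWithinAt (fun s => max (f s) 0) (e * f') (Set.Ici t) t := by
  have hpos : (∀ᶠ s in nhdsWithin t (Set.Ioi t), 0 < f s) → 0 ≤ f t →
      HasDerivWithinAt (fun s => max (f s) 0) (1 * f') (Set.Ici t) t := by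
    intro h h0
    rw [← hasDerivWithinAt_Ioi_iff_Ici] at hf ⊢
    rw [one_mul]
    refine hf.congr_of_eventuallyEq ?_ (max_eq_left h0)
    filter_upwards [h] with s hs using max_eq_left hs.le
  have hneg : (∀ᶠ s in nhdsWithin t (Set.Ioi t), f s < 0) → f t ≤ 0 →
      HasDerivWithinAt (fun s => max (f s) 0) (0 * f') (Set.Ici t) t := by
    intro h h0
    rw [← hasDerivWithinAt_Ioi_iff_Ici]
    rw [zero_mul]
    refine (hasDerivWithinAt_const t _ (0 : ℝ)).congr_of_eventuallyEq ?_ (max_eq_right h0)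
    filter_upwards [h] with s hs using max_eq_right hs.le
  have hcont : Filter.Tendsto f (nhdsWithin t (Set.Ioi t)) (nhds (f t)) :=
    hf.continuousWithinAt.mono Set.Ioi_subset_Ici_self
  rcases lt_trichotomy (f t) 0 with h | h | h
  · exact ⟨0, Or.inl ⟨rfl, h.le⟩, hneg (hcont.eventually_lt_const h) h.le⟩
  · have hslope := (hasDerivWithinAt_iff_tendsto_slope' (by simp)).1
      (hasDerivWithinAt_Ioi_iff_Ici.2 hf)
    rcases lt_trichotomy f' 0 with h' | h' | h'
    · refine ⟨0, Or.inl ⟨rfl, h.le⟩, hneg ?_ h.le⟩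
      filter_upwards [hslope.eventually_lt_const h', self_mem_nhdsWithin] with s hs hst
      rw [slope_def_field, h, sub_zero, div_neg_iff] at hs
      have : 0 < s - t := sub_pos.2 hst
      rcases hs with hs | hs
      · linarith [hs.2]
      · exact hs.1
    · refine ⟨0, Or.inl ⟨rfl, h.le⟩, ?_⟩
      rw [zero_mul]
      subst h'
      rw [hasDerivWithinAt_iff_isLittleO] at hf ⊢
      refine (Asymptotics.isBigO_of_le _ fun s => ?_).trans_isLittleO hf
      simp only [h, max_self, sub_zero, smul_zero, Real.norm_eq_abs]
      rw [abs_of_nonneg (le_max_right _ _)]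
      exact max_le (le_abs_self _) (abs_nonneg _)
    · refine ⟨1, Or.inr ⟨rfl, h.ge⟩, hpos ?_ h.ge⟩
      filter_upwards [hslope.eventually_const_lt h', self_mem_nhdsWithin] with s hs hst
      rw [slope_def_field, h, sub_zero] at hs
      have : 0 < s - t := sub_pos.2 hst
      exact (div_pos_iff_of_pos_right this).1 hs
  · exact ⟨1, Or.inr ⟨rfl, h.le⟩, hpos (hcont.eventually_const_lt h) h.le⟩

lemma le_exp_mul_of_deriv_right_le {T a : ℝ} {f f' B B' : ℝ → ℝ}
    (hf : ContinuousOn f (Set.Icc 0 T))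
    (hf' : ∀ t ∈ Set.Ico 0 T, HasDerivWithinAt f (f' t) (Set.Ici t) t)
    (hB : ∀ t, HasDerivAt B (B' t) t) (h0 : f 0 ≤ B 0)
    (hle : ∀ t ∈ Set.Ico 0 T, f' t ≤ -a * f t + Real.exp (-a * t) * B' t) :
    ∀ t ∈ Set.Icc 0 T, f t ≤ Real.exp (-a * t) * B t := by
  intro t ht
  have hexp : ∀ s, HasDerivAt (fun s => Real.exp (a * s)) (Real.exp (a * s) * a) s := by
    intro s
    simpa using ((hasDerivAt_id s).const_mul a).exp
  have key := image_le_of_deriv_right_le_deriv_boundary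
    (f := fun s => Real.exp (a * s) * f s)
    (f' := fun s => Real.exp (a * s) * a * f s + Real.exp (a * s) * f' s)
    (a := 0) (b := T) (B := B) (B' := B')
    ((by fun_prop : Continuous fun s => Real.exp (a * s)).continuousOn.mul hf)
    (fun s hs => (hexp s).hasDerivWithinAt.mul (hf' s hs))
    (by simpa using h0)
    (fun s _ => (hB s).continuousAt.continuousWithinAt)
    (fun s _ => (hB s).hasDerivWithinAt)
    (fun s hs => by
      have h := mul_le_mul_of_nonneg_left (hle s hs) (Real.exp_pos (a * s)).le
      have he : Real.exp (a * s) * Real.exp (-a * s) = 1 := by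
        rw [← Real.exp_add]; simp
      have : Real.exp (a * s) * (-a * f s + Real.exp (-a * s) * B' s)
        = -(Real.exp (a * s) * a * f s) + B' s := by
        linear_combination B' s * he
      linarith) ht
  have he : Real.exp (-a * t) * Real.exp (a * t) = 1 := by
    rw [← Real.exp_add]; simp
  calc f t = Real.exp (-a * t) * (Real.exp (a * t) * f t) := by rw [← mul_assoc, he, one_mul]
    _ ≤ _ := mul_le_mul_of_nonneg_left key (Real.exp_pos _).le

/-- The second difference of `n ↦ n ^ r`, extended evenly, divided by two at `0`. -/
noncomputable def costWeight (r : ℝ) (d : ℕ) : ℝ :=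
  if d = 0 then 1 else ((d : ℝ) + 1) ^ r - 2 * (d : ℝ) ^ r + ((d : ℝ) - 1) ^ r

/-- The indicator of `{x ≤ j}`. -/
def lowerInd (j x : ℕ) : ℝ := if x ≤ j then 1 else 0

/-- The cost `|x - y| ^ r` truncated at level `M`, as a combination of indicators of quadrants. -/
noncomputable def truncCost (r : ℝ) (M x y : ℕ) : ℝ :=
  ∑ j ∈ Finset.range M, ∑ i ∈ Finset.range (j + 1), costWeight r (j - i) *
    (lowerInd i y * (1 - lowerInd j x) + lowerInd i x * (1 - lowerInd j y))

/-- The generator of a birth and death process. -/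
def bdGen (η ν : ℕ → ℝ) (f : ℕ → ℝ) (x : ℕ) : ℝ :=
  η x * (f (x + 1) - f x) + ν x * (f (x - 1) - f x)

/-- The generator of the coupling in which both coordinates jump together as often as possible. -/
noncomputable def bdCouplingGen (η ν : ℕ → ℝ) (f : ℕ → ℕ → ℝ) (x y : ℕ) : ℝ :=
  min (η x) (η y) * (f (x + 1) (y + 1) - f x y)
    + (η x - min (η x) (η y)) * (f (x + 1) y - f x y)
    + (η y - min (η x) (η y)) * (f x (y + 1) - f x y)
    + (min (ν x) (ν y) * (f (x - 1) (y - 1) - f x y)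
    + (ν x - min (ν x) (ν y)) * (f (x - 1) y - f x y)
    + (ν y - min (ν x) (ν y)) * (f x (y - 1) - f x y))

lemma costWeight_nonneg {r : ℝ} (hr : 1 ≤ r) (d : ℕ) : 0 ≤ costWeight r d := by
  unfold costWeight
  split_ifs with h
  · exact zero_le_one
  · have h1 : (1 : ℝ) ≤ d := by exact_mod_cast Nat.one_le_iff_ne_zero.2 h
    have hmem : (d : ℝ) + 1 ∈ Set.Ici 0 ∧ (d : ℝ) - 1 ∈ Set.Ici 0 := by
      simp only [Set.mem_Ici]
      constructor <;> linarith
    have := (convexOn_rpow hr).2 hmem.1 hmem.2 (by norm_num : (0 : ℝ) ≤ 1 / 2)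
      (by norm_num : (0 : ℝ) ≤ 1 / 2) (by norm_num)
    simp only [smul_eq_mul] at this
    rw [show (1 : ℝ) / 2 * (d + 1) + 1 / 2 * (d - 1) = d by ring] at this
    linarith

lemma sum_costWeight_mul_lowerInd {r : ℝ} (hr : 0 < r) (M y : ℕ) :
    ∑ i ∈ Finset.range (M + 1), costWeight r (M - i) * lowerInd i y
      = ((M + 1 - y : ℕ) : ℝ) ^ r - ((M - y : ℕ) : ℝ) ^ r := by
  induction M generalizing y with
  | zero =>
    rcases y with _ | y
    · simp [costWeight, lowerInd, hr.ne']
    · simp [lowerInd, hr.ne']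
  | succ M ih =>
    rw [Finset.sum_range_succ']
    have h : ∀ i ∈ Finset.range (M + 1), costWeight r (M + 1 - (i + 1)) * lowerInd (i + 1) y
        = costWeight r (M - i) * lowerInd i (y - 1) := by
      intro i _
      rw [Nat.add_sub_add_right]
      congr 1
      simp [lowerInd]
    rw [Finset.sum_congr rfl h, ih]
    rcases y with _ | y
    · simp [costWeight, lowerInd]
      ring_nf
    · simp [lowerInd]

lemma sum_costWeight_quadrant {r : ℝ} (hr : 0 < r) (M x y : ℕ) :
    ∑ j ∈ Finset.range M, ∑ i ∈ Finset.range (j + 1), costWeight r (j - i) *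
      (lowerInd i y * (1 - lowerInd j x)) = ((min x M - min y M : ℕ) : ℝ) ^ r := by
  induction M with
  | zero => simp [hr.ne']
  | succ M ih =>
    rw [Finset.sum_range_succ, ih]
    simp_rw [← mul_assoc]
    rw [← Finset.sum_mul, sum_costWeight_mul_lowerInd hr]
    by_cases hx : x ≤ M
    · simp only [lowerInd, hx, if_true, sub_self, mul_zero, add_zero]
      congr 2
      omega
    · simp only [lowerInd, hx, if_false, sub_zero, mul_one]
      have h1 : min x M - min y M = M - y := by omega
      have h2 : min x (M + 1) - min y (M + 1) = M + 1 - y := by omega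
      rw [h1, h2]
      ring

lemma truncCost_eq {r : ℝ} (hr : 0 < r) (M x y : ℕ) :
    truncCost r M x y = |((min x M : ℕ) : ℝ) - (min y M : ℕ)| ^ r := by
  unfold truncCost
  simp_rw [mul_add, Finset.sum_add_distrib]
  rw [sum_costWeight_quadrant hr, sum_costWeight_quadrant hr]
  rcases le_total (min x M) (min y M) with h | h
  · rw [Nat.sub_eq_zero_of_le h, Nat.cast_zero, Real.zero_rpow hr.ne', zero_add, Nat.cast_sub h,
      abs_sub_comm, abs_of_nonneg (sub_nonneg.2 (Nat.cast_le.2 h))]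
  · rw [Nat.sub_eq_zero_of_le h, Nat.cast_zero, Real.zero_rpow hr.ne', add_zero, Nat.cast_sub h,
      abs_of_nonneg (sub_nonneg.2 (Nat.cast_le.2 h))]

lemma truncCost_comm {r : ℝ} (M x y : ℕ) : truncCost r M x y = truncCost r M y x := by
  unfold truncCost
  simp_rw [add_comm]

lemma truncCost_nonneg {r : ℝ} (hr : 0 < r) (M x y : ℕ) : 0 ≤ truncCost r M x y := by
  rw [truncCost_eq hr]
  positivity

lemma abs_min_sub_min_le (M x y : ℕ) :
    |((min x M : ℕ) : ℝ) - (min y M : ℕ)| ≤ |(x : ℝ) - y| := by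
  push_cast
  have := abs_min_sub_min_le_max (x : ℝ) M y M
  simpa using this

lemma truncCost_le {r : ℝ} (hr : 0 < r) (M x y : ℕ) :
    truncCost r M x y ≤ |(x : ℝ) - y| ^ r := by
  rw [truncCost_eq hr]
  exact Real.rpow_le_rpow (abs_nonneg _) (abs_min_sub_min_le M x y) hr.le

lemma bdCouplingGen_comm {η ν : ℕ → ℝ} {f : ℕ → ℕ → ℝ} (hf : ∀ x y, f x y = f y x) (x y : ℕ) :
    bdCouplingGen η ν f x y = bdCouplingGen η ν f y x := by
  unfold bdCouplingGen
  rw [hf y x, hf (y + 1) (x + 1), hf (y + 1) x, hf y (x + 1), hf (y - 1) (x - 1), hf (y - 1) x,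
    hf y (x - 1), min_comm (η y), min_comm (ν y)]
  ring

lemma bdGen_add_bdGen_le {η ν : ℕ → ℝ} (hη0 : ∀ x, 0 ≤ η x) (hν0 : ∀ x, 0 ≤ ν x)
    {a b : ℕ → ℝ} {f : ℕ → ℕ → ℝ} (hle : ∀ x y, a x + b y ≤ f x y) {x y : ℕ}
    (heq : a x + b y = f x y) :
    bdGen η ν a x + bdGen η ν b y ≤ bdCouplingGen η ν f x y := by
  have key : ∀ c : ℝ, 0 ≤ c → ∀ x' y', c * (a x' + b y' - (a x + b y)) ≤ c * (f x' y' - f x y) :=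
    fun c hc x' y' => mul_le_mul_of_nonneg_left (by linarith [hle x' y']) hc
  have h1 := key _ (le_min (hη0 x) (hη0 y)) (x + 1) (y + 1)
  have h2 := key _ (sub_nonneg.2 (min_le_left (η x) (η y))) (x + 1) y
  have h3 := key _ (sub_nonneg.2 (min_le_right (η x) (η y))) x (y + 1)
  have h4 := key _ (le_min (hν0 x) (hν0 y)) (x - 1) (y - 1)
  have h5 := key _ (sub_nonneg.2 (min_le_left (ν x) (ν y))) (x - 1) y
  have h6 := key _ (sub_nonneg.2 (min_le_right (ν x) (ν y))) x (y - 1)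
  unfold bdGen bdCouplingGen
  linarith

lemma bdCouplingGen_sum {ι : Type*} {η ν : ℕ → ℝ} (s : Finset ι) (w : ι → ℝ)
    (f : ι → ℕ → ℕ → ℝ) (x y : ℕ) :
    bdCouplingGen η ν (fun x y => ∑ k ∈ s, w k * f k x y) x y
      = ∑ k ∈ s, w k * bdCouplingGen η ν (f k) x y := by
  unfold bdCouplingGen
  simp only [mul_add, Finset.sum_add_distrib, ← Finset.sum_sub_distrib, Finset.mul_sum]
  congr 1
  · congr 1
    · congr 1
      · exact Finset.sum_congr rfl fun _ _ => by ring
      · exact Finset.sum_congr rfl fun _ _ => by ring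
    · exact Finset.sum_congr rfl fun _ _ => by ring
  · congr 1
    · congr 1
      · exact Finset.sum_congr rfl fun _ _ => by ring
      · exact Finset.sum_congr rfl fun _ _ => by ring
    · exact Finset.sum_congr rfl fun _ _ => by ring

lemma bdGen_lowerInd (η ν : ℕ → ℝ) (j x : ℕ) :
    bdGen η ν (lowerInd j) x
      = (if x = j then -η j else 0) + (if x = j + 1 then ν (j + 1) else 0) := by
  unfold bdGen lowerInd
  rcases lt_trichotomy x j with h | h | h
  · simp [show x ≠ j by omega, show x ≠ j + 1 by omega, show x ≤ j by omega,
      show x + 1 ≤ j by omega, show x ≤ j + 1 by omega]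
  · subst h
    simp
  · rcases eq_or_ne x (j + 1) with h' | h'
    · subst h'
      simp
    · simp [h', show ¬ x ≤ j by omega, show x ≠ j by omega, show ¬ x ≤ j + 1 by omega,
        show ¬ x + 1 ≤ j by omega]

lemma mul_bdGen_lowerInd_le {η ν : ℕ → ℝ} (hη0 : ∀ x, 0 ≤ η x) (hν0 : ∀ x, 0 ≤ ν x)
    {e : ℝ} {F G : ℕ → ℝ} {i j x y : ℕ}
    (he : e = 0 ∧ G i - F j ≤ 0 ∨ e = 1 ∧ 0 ≤ G i - F j)
    (hxy : x ≤ j → i < y → G i < F j) (hyx : y ≤ i → j < x → F j < G i) :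
    e * (bdGen η ν (lowerInd i) y - bdGen η ν (lowerInd j) x)
      ≤ bdCouplingGen η ν (fun x y => lowerInd i y * (1 - lowerInd j x)) x y := by
  have h := bdGen_add_bdGen_le (η := η) (ν := ν) hη0 hν0 (a := fun x => -e * lowerInd j x)
    (b := fun y => e * lowerInd i y) (f := fun x y => lowerInd i y * (1 - lowerInd j x))
    (x := x) (y := y) ?_ ?_
  · refine le_trans (le_of_eq ?_) h
    unfold bdGen
    ring
  · intro x y
    unfold lowerInd
    rcases he with ⟨rfl, -⟩ | ⟨rfl, -⟩ <;> split_ifs <;> norm_num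
  · unfold lowerInd
    rcases he with ⟨rfl, h0⟩ | ⟨rfl, h0⟩ <;> split_ifs with h1 h2 h2 <;> norm_num
    · linarith [hyx h2 (not_le.1 h1)]
    · linarith [hxy h1 (not_le.1 h2)]

lemma bdKappa_le {η ν : ℕ → ℝ}
    (hκ : BddBelow (Set.range fun x : ℕ => η x + ν (x + 1) - η (x + 1) - ν x)) (x n : ℕ) :
    η (x + n) - ν (x + n) - (η x - ν x) ≤ -bdKappa η ν * n := by
  induction n with
  | zero => simp
  | succ n ih =>
    have := ciInf_le hκ (x + n)
    rw [← add_assoc]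
    push_cast
    unfold bdKappa at ih ⊢
    linarith

lemma bdLip_nonneg (f : ℕ → ℝ) : 0 ≤ bdLip f := Real.iSup_nonneg fun _ => abs_nonneg _

lemma abs_sub_le_bdLip {f : ℕ → ℝ} (hf : BddAbove (Set.range fun x : ℕ => |f (x + 1) - f x|))
    (x n : ℕ) : |f (x + n) - f x| ≤ bdLip f * n := by
  induction n with
  | zero => simp
  | succ n ih =>
    have h1 := le_ciSup hf (x + n)
    have h2 := abs_sub_le (f (x + n + 1)) (f (x + n)) (f x)
    rw [← add_assoc]
    push_cast
    unfold bdLip at ih ⊢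
    linarith

/-- The two one-step Taylor bounds for `n ↦ n ^ r` with error `θ`. -/
def StepBound (r θ : ℝ) : Prop :=
  ∀ n : ℕ, 1 ≤ n → ((n : ℝ) + 1) ^ r - (n : ℝ) ^ r ≤ r * (n : ℝ) ^ (r - 1) + θ ∧
    ((n : ℝ) - 1) ^ r - (n : ℝ) ^ r ≤ -(r * (n : ℝ) ^ (r - 1)) + θ

lemma stepBound_one : StepBound 1 0 := by
  intro n _
  simp

lemma stepBound_of_mem {r : ℝ} (hr1 : 1 < r) (hr2 : r ≤ 2) : StepBound r 1 := by
  intro n hn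
  have hn' : (1 : ℝ) ≤ n := by exact_mod_cast hn
  have h1 := rpow_add_le_taylor hr1 hr2 (Nat.cast_nonneg n) zero_le_one
  have h2 := rpow_le_taylor_sub hr1 hr2 (sub_nonneg.2 hn') zero_le_one
  rw [sub_add_cancel] at h2
  rw [Real.one_rpow, mul_one] at h1 h2
  constructor <;> linarith

lemma bdCouplingGen_abs_rpow_le {η ν : ℕ → ℝ} (hν0 : ∀ x, 0 ≤ ν x) (hν : ν 0 = 0)
    (hκ : BddBelow (Set.range fun x : ℕ => η x + ν (x + 1) - η (x + 1) - ν x))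
    (hLipη : BddAbove (Set.range fun x : ℕ => |η (x + 1) - η x|))
    (hLipν : BddAbove (Set.range fun x : ℕ => |ν (x + 1) - ν x|))
    {r θ : ℝ} (hr : 1 ≤ r) (hθ : 0 ≤ θ) (hstep : StepBound r θ) (x y : ℕ) :
    bdCouplingGen η ν (fun x y => |(x : ℝ) - y| ^ r) x y
      ≤ -(bdKappa η ν * r) * |(x : ℝ) - y| ^ r
        + θ * (bdLip η + bdLip ν) * |(x : ℝ) - y| := by
  wlog hyx : y ≤ x generalizing x y
  · have := this y x (le_of_not_ge hyx)
    rwa [abs_sub_comm, bdCouplingGen_comm (fun x y => by rw [abs_sub_comm])]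
  obtain ⟨n, rfl⟩ := Nat.exists_eq_add_of_le hyx
  rcases Nat.eq_zero_or_pos n with rfl | hn
  · simp [bdCouplingGen, Real.zero_rpow (by linarith : r ≠ 0)]
  obtain ⟨h1, h2⟩ := hstep n hn
  have hn' : (1 : ℝ) ≤ n := by exact_mod_cast hn
  have hcost : ∀ a b : ℕ, ∀ c : ℝ, 0 ≤ c → (a : ℝ) - b = c → |(a : ℝ) - b| ^ r = c ^ r := by
    intro a b c hc h
    rw [h, abs_of_nonneg hc]
  have e1 := hcost (y + n + 1) (y + 1) n (by linarith) (by push_cast; ring)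
  have e2 := hcost (y + n + 1) y (n + 1) (by linarith) (by push_cast; ring)
  have e3 := hcost (y + n) (y + 1) (n - 1) (by linarith) (by push_cast; ring)
  have e4 := hcost (y + n - 1) y (n - 1) (by linarith)
    (by rw [Nat.cast_sub (by omega)]; push_cast; ring)
  have habs : |((y + n : ℕ) : ℝ) - y| = n := by
    push_cast
    rw [add_sub_cancel_left, abs_of_nonneg (by linarith)]
  have hdown : min (ν (y + n)) (ν y) * (|((y + n - 1 : ℕ) : ℝ) - (y - 1 : ℕ)| ^ r
        - (n : ℝ) ^ r) = 0 ∧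
      (ν y - min (ν (y + n)) (ν y)) * (|((y + n : ℕ) : ℝ) - (y - 1 : ℕ)| ^ r - (n : ℝ) ^ r)
        ≤ (ν y - min (ν (y + n)) (ν y)) * (r * (n : ℝ) ^ (r - 1) + θ) := by
    rcases Nat.eq_zero_or_pos y with rfl | hy
    · rw [hν, min_eq_right (hν0 _)]
      simp
    · rw [hcost (y + n - 1) (y - 1) n (by linarith)
          (by rw [Nat.cast_sub (by omega), Nat.cast_sub (by omega)]; push_cast; ring),
        hcost (y + n) (y - 1) (n + 1) (by linarith)
          (by rw [Nat.cast_sub (by omega)]; push_cast; ring), sub_self, mul_zero]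
      exact ⟨rfl, mul_le_mul_of_nonneg_left h1 (sub_nonneg.2 (min_le_right _ _))⟩
  have b1 := mul_le_mul_of_nonneg_left h1 (sub_nonneg.2 (min_le_left (η (y + n)) (η y)))
  have b2 := mul_le_mul_of_nonneg_left h2 (sub_nonneg.2 (min_le_right (η (y + n)) (η y)))
  have b3 := mul_le_mul_of_nonneg_left h2 (sub_nonneg.2 (min_le_left (ν (y + n)) (ν y)))
  have habs_eq : ∀ a b : ℝ, (a - min a b) + (b - min a b) = |a - b| := by
    intro a b
    rcases le_total a b with h | h
    · rw [min_eq_left h, abs_sub_comm, abs_of_nonneg (by linarith)]; ring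
    · rw [min_eq_right h, abs_of_nonneg (by linarith)]; ring
  have hη' := abs_sub_le_bdLip hLipη y n
  have hν' := abs_sub_le_bdLip hLipν y n
  rw [← habs_eq] at hη' hν'
  have hlip := mul_le_mul_of_nonneg_left (add_le_add hη' hν') hθ
  have hpow : (n : ℝ) ^ (r - 1) * n = (n : ℝ) ^ r := by
    nth_rewrite 2 [← Real.rpow_one (n : ℝ)]
    rw [← Real.rpow_add (by linarith)]
    congr 1
    ring
  have hcurv := mul_le_mul_of_nonneg_left (bdKappa_le hκ y n)
    (by positivity : 0 ≤ r * (n : ℝ) ^ (r - 1))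
  unfold bdCouplingGen
  simp only [e1, e2, e3, e4, habs]
  have hk : r * (n : ℝ) ^ (r - 1) * (-bdKappa η ν * n) = -(bdKappa η ν * r) * (n : ℝ) ^ r := by
    rw [← hpow]
    ring
  rw [hk] at hcurv
  linarith [hdown.1, hdown.2]

/-- A Lyapunov function that dominates `(x + 1) ^ ρ` on `{M ≤ x}` and vanishes as `M → ∞`. -/
noncomputable def tailFun (ρ : ℝ) (M x : ℕ) : ℝ :=
  ((x : ℝ) + 1) ^ ρ * min 1 (((x : ℝ) + 1) / (M + 1))

lemma tailFun_nonneg (ρ : ℝ) (M x : ℕ) : 0 ≤ tailFun ρ M x := by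
  unfold tailFun
  positivity

lemma tailFun_eq {ρ : ℝ} {M x : ℕ} (h : M ≤ x) : tailFun ρ M x = ((x : ℝ) + 1) ^ ρ := by
  unfold tailFun
  rw [min_eq_left, mul_one]
  rw [one_le_div (by positivity)]
  gcongr

lemma tailFun_le (ρ : ℝ) (M x : ℕ) : tailFun ρ M x ≤ ((x : ℝ) + 1) ^ ρ := by
  unfold tailFun
  exact mul_le_of_le_one_right (by positivity) (min_le_left _ _)

lemma tailFun_mono {ρ : ℝ} (hρ : 0 ≤ ρ) (M : ℕ) : Monotone (tailFun ρ M) := by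
  intro x y h
  unfold tailFun
  gcongr

lemma succ_mul_tailFun_sub_le {ρ : ℝ} (hρ2 : ρ ≤ 2) (M x : ℕ) :
    (1 + x) * (tailFun ρ M (x + 1) - tailFun ρ M x) ≤ 7 * tailFun ρ M x := by
  set a : ℝ := x + 1 with ha
  have ha1 : 1 ≤ a := by simp [ha]
  have h1 : (a + 1) ^ ρ ≤ (1 + 1 / a) ^ 2 * a ^ ρ := by
    have : a + 1 = (1 + 1 / a) * a := by field_simp
    rw [this, Real.mul_rpow (by positivity) (by positivity)]
    gcongr
    rw [← Real.rpow_two]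
    exact Real.rpow_le_rpow_of_exponent_le (by simp; positivity) hρ2
  have h2 : min 1 ((a + 1) / (M + 1)) ≤ (1 + 1 / a) * min 1 (a / (M + 1)) := by
    rw [mul_min_of_nonneg _ _ (by positivity)]
    refine min_le_min (by simp; positivity) (le_of_eq ?_)
    field_simp
  have h3 : tailFun ρ M (x + 1) ≤ (1 + 1 / a) ^ 3 * tailFun ρ M x := by
    unfold tailFun
    push_cast
    rw [← ha]
    calc _ ≤ ((1 + 1 / a) ^ 2 * a ^ ρ) * ((1 + 1 / a) * min 1 (a / (M + 1))) := by gcongr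
      _ = _ := by ring
  have h4 : a * ((1 + 1 / a) ^ 3 - 1) ≤ 7 := by
    have hb : 1 / a ≤ 1 := by rw [div_le_one (by linarith)]; exact ha1
    have hb0 : 0 ≤ 1 / a := by positivity
    have : a * ((1 + 1 / a) ^ 3 - 1) = 3 + 3 * (1 / a) + (1 / a) ^ 2 := by
      field_simp
      ring
    rw [this]
    nlinarith
  have h5 := tailFun_nonneg ρ M x
  calc (1 + x) * (tailFun ρ M (x + 1) - tailFun ρ M x)
      ≤ a * ((1 + 1 / a) ^ 3 * tailFun ρ M x - tailFun ρ M x) := by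
        rw [add_comm 1 (x : ℝ), ← ha]
        gcongr
    _ = (a * ((1 + 1 / a) ^ 3 - 1)) * tailFun ρ M x := by ring
    _ ≤ _ := by gcongr

lemma bdCouplingGen_truncCost_le_tailFun {η ν : ℕ → ℝ} (hη0 : ∀ x, 0 ≤ η x) (hν0 : ∀ x, 0 ≤ ν x)
    {K : ℝ} (hK : ∀ x : ℕ, η x ≤ K * (1 + x)) (hK' : ∀ x : ℕ, ν x ≤ K * (1 + x))
    {r ρ : ℝ} (hr : 1 ≤ r) (hr2 : r ≤ 2) (hrρ : r ≤ ρ) {M x y : ℕ} (hyx : y ≤ x) (hM : M ≤ x) :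
    bdCouplingGen η ν (truncCost r M) x y ≤ 6 * K * tailFun ρ M x := by
  have hr0 : 0 < r := by linarith
  set n : ℝ := |((min x M : ℕ) : ℝ) - (min y M : ℕ)| with hn
  have hn0 : 0 ≤ n := abs_nonneg _
  have hnx : n ≤ x := by
    refine (abs_min_sub_min_le M x y).trans ?_
    have : (y : ℝ) ≤ x := by exact_mod_cast hyx
    rw [abs_of_nonneg (by linarith)]
    simp
  have hK0 : 0 ≤ K := by simpa using (hη0 0).trans (hK 0)
  have hx0 : (0 : ℝ) ≤ x := Nat.cast_nonneg x
  have hinc : (n + 1) ^ r - n ^ r ≤ 3 * ((x : ℝ) + 1) ^ (r - 1) := by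
    have h1 : (1 : ℝ) ≤ ((x : ℝ) + 1) ^ (r - 1) :=
      Real.one_le_rpow (by linarith) (by linarith)
    rcases hr.eq_or_lt with rfl | hr1
    · simp
    · have h2 := rpow_add_le_taylor hr1 hr2 hn0 zero_le_one
      rw [mul_one, Real.one_rpow] at h2
      have h3 : n ^ (r - 1) ≤ ((x : ℝ) + 1) ^ (r - 1) :=
        Real.rpow_le_rpow hn0 (by linarith) (by linarith)
      have h4 : 0 ≤ n ^ (r - 1) := by positivity
      nlinarith
  have hmove : ∀ x' y' : ℕ, |((min x' M : ℕ) : ℝ) - (min y' M : ℕ)| ≤ n + 1 →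
      truncCost r M x' y' - truncCost r M x y ≤ 3 * ((x : ℝ) + 1) ^ (r - 1) := by
    intro x' y' h
    rw [truncCost_eq hr0, truncCost_eq hr0, ← hn]
    have := Real.rpow_le_rpow (abs_nonneg _) h hr0.le
    linarith
  have hint : ∀ x' y' : ℕ,
      min x' M + min y M ≤ min y' M + min x M + 1 ∧ min y' M + min y M ≤ min x' M + min x M + 1 →
      |((min x' M : ℕ) : ℝ) - (min y' M : ℕ)| ≤ n + 1 := by
    intro x' y' h
    have h1 : ((min x' M + min y M : ℕ) : ℝ) ≤ (min y' M + min x M + 1 : ℕ) := by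
      exact_mod_cast h.1
    have h2 : ((min y' M + min y M : ℕ) : ℝ) ≤ (min x' M + min x M + 1 : ℕ) := by
      exact_mod_cast h.2
    rw [Nat.cast_add, Nat.cast_add, Nat.cast_add, Nat.cast_one] at h1 h2
    have h3 := le_abs_self (((min x M : ℕ) : ℝ) - (min y M : ℕ))
    rw [← hn] at h3
    rw [abs_le]
    constructor <;> linarith
  have key : ∀ c : ℝ, 0 ≤ c → ∀ x' y',
      min x' M + min y M ≤ min y' M + min x M + 1 ∧ min y' M + min y M ≤ min x' M + min x M + 1 →
      c * (truncCost r M x' y' - truncCost r M x y) ≤ c * (3 * ((x : ℝ) + 1) ^ (r - 1)) :=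
    fun c hc x' y' h => mul_le_mul_of_nonneg_left (hmove x' y' (hint x' y' h)) hc
  have h1 := key _ (le_min (hη0 x) (hη0 y)) (x + 1) (y + 1) (by omega)
  have h2 := key _ (sub_nonneg.2 (min_le_left (η x) (η y))) (x + 1) y (by omega)
  have h3 := key _ (sub_nonneg.2 (min_le_right (η x) (η y))) x (y + 1) (by omega)
  have h4 := key _ (le_min (hν0 x) (hν0 y)) (x - 1) (y - 1) (by omega)
  have h5 := key _ (sub_nonneg.2 (min_le_left (ν x) (ν y))) (x - 1) y (by omega)
  have h6 := key _ (sub_nonneg.2 (min_le_right (ν x) (ν y))) x (y - 1) (by omega)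
  have hrate : ∀ f : ℕ → ℝ, (∀ x : ℕ, f x ≤ K * (1 + x)) →
      f x + f y - min (f x) (f y) ≤ K * (1 + x) := by
    intro f hf
    have hy : f y ≤ K * (1 + x) := (hf y).trans (by gcongr)
    rcases le_total (f x) (f y) with h | h
    · rw [min_eq_left h]; linarith
    · rw [min_eq_right h]; linarith [hf x]
  have hpos : 0 ≤ 3 * ((x : ℝ) + 1) ^ (r - 1) := by positivity
  have hs := mul_le_mul_of_nonneg_right (add_le_add (hrate η hK) (hrate ν hK')) hpos
  have hpow : (1 + (x : ℝ)) * ((x : ℝ) + 1) ^ (r - 1) ≤ ((x : ℝ) + 1) ^ ρ := by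
    nth_rewrite 1 [add_comm, ← Real.rpow_one ((x : ℝ) + 1)]
    rw [← Real.rpow_add (by linarith)]
    exact Real.rpow_le_rpow_of_exponent_le (by linarith) (by linarith)
  have hfin := mul_le_mul_of_nonneg_left hpow (by linarith : 0 ≤ 6 * K)
  rw [tailFun_eq hM]
  unfold bdCouplingGen
  linarith

lemma bdCouplingGen_truncCost_le {η ν : ℕ → ℝ} (hη0 : ∀ x, 0 ≤ η x) (hν0 : ∀ x, 0 ≤ ν x)
    (hν : ν 0 = 0)
    (hκ : BddBelow (Set.range fun x : ℕ => η x + ν (x + 1) - η (x + 1) - ν x))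
    (hLipη : BddAbove (Set.range fun x : ℕ => |η (x + 1) - η x|))
    (hLipν : BddAbove (Set.range fun x : ℕ => |ν (x + 1) - ν x|))
    {K : ℝ} (hK : ∀ x : ℕ, η x ≤ K * (1 + x)) (hK' : ∀ x : ℕ, ν x ≤ K * (1 + x))
    {r ρ θ : ℝ} (hr : 1 ≤ r) (hr2 : r ≤ 2) (hrρ : r ≤ ρ) (hθ : 0 ≤ θ) (hstep : StepBound r θ)
    (M x y : ℕ) :
    bdCouplingGen η ν (truncCost r M) x y
      ≤ -(bdKappa η ν * r) * truncCost r M x y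
        + θ * (bdLip η + bdLip ν) * truncCost 1 M x y
        + (6 * K + 2 * |bdKappa η ν|) * (tailFun ρ M x + tailFun ρ M y) := by
  wlog hyx : y ≤ x generalizing x y
  · have := this y x (le_of_not_ge hyx)
    rw [bdCouplingGen_comm (truncCost_comm M), truncCost_comm M x, truncCost_comm M x,
      add_comm (tailFun ρ M x)]
    exact this
  have hr0 : 0 < r := by linarith
  have hK0 : 0 ≤ K := by simpa using (hη0 0).trans (hK 0)
  have hA : 0 ≤ 6 * K + 2 * |bdKappa η ν| := by positivity
  rcases lt_or_ge x M with hx | hx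
  · have hloc : ∀ s : ℝ, 0 < s → ∀ a b : ℕ, a ≤ M → b ≤ M →
        truncCost s M a b = |(a : ℝ) - b| ^ s := by
      intro s hs a b ha hb
      rw [truncCost_eq hs, min_eq_left ha, min_eq_left hb]
    have h := bdCouplingGen_abs_rpow_le hν0 hν hκ hLipη hLipν hr hθ hstep x y
    have heq : bdCouplingGen η ν (truncCost r M) x y
        = bdCouplingGen η ν (fun x y => |(x : ℝ) - y| ^ r) x y := by
      unfold bdCouplingGen
      simp only
      rw [hloc r hr0 (x + 1) (y + 1) (by omega) (by omega), hloc r hr0 x y (by omega) (by omega),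
        hloc r hr0 (x + 1) y (by omega) (by omega), hloc r hr0 x (y + 1) (by omega) (by omega),
        hloc r hr0 (x - 1) (y - 1) (by omega) (by omega),
        hloc r hr0 (x - 1) y (by omega) (by omega), hloc r hr0 x (y - 1) (by omega) (by omega)]
    rw [heq, hloc r hr0 x y (by omega) (by omega), hloc 1 one_pos x y (by omega) (by omega),
      Real.rpow_one]
    have := mul_nonneg hA (add_nonneg (tailFun_nonneg ρ M x) (tailFun_nonneg ρ M y))
    linarith
  · have h1 := bdCouplingGen_truncCost_le_tailFun hη0 hν0 hK hK' hr hr2 hrρ hyx hx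
    have hc0 := truncCost_nonneg hr0 M x y
    have hc : truncCost r M x y ≤ tailFun ρ M x := by
      rw [tailFun_eq hx]
      have hx0 : (0 : ℝ) ≤ x := Nat.cast_nonneg x
      have hyx' : (y : ℝ) ≤ x := by exact_mod_cast hyx
      calc truncCost r M x y ≤ |(x : ℝ) - y| ^ r := truncCost_le hr0 M x y
        _ ≤ ((x : ℝ) + 1) ^ r := by
          refine Real.rpow_le_rpow (abs_nonneg _) ?_ hr0.le
          rw [abs_of_nonneg (by linarith)]
          linarith [(Nat.cast_nonneg y : (0 : ℝ) ≤ y)]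
        _ ≤ _ := Real.rpow_le_rpow_of_exponent_le (by linarith) hrρ
    have h2 : bdKappa η ν * r * truncCost r M x y ≤ 2 * |bdKappa η ν| * tailFun ρ M x := by
      have ha := le_abs_self (bdKappa η ν)
      calc bdKappa η ν * r * truncCost r M x y
          ≤ |bdKappa η ν| * 2 * truncCost r M x y := by gcongr
        _ ≤ |bdKappa η ν| * 2 * tailFun ρ M x := by gcongr
        _ = _ := by ring
    have h3 := mul_nonneg (mul_nonneg hθ (add_nonneg (bdLip_nonneg η) (bdLip_nonneg ν)))
      (truncCost_nonneg one_pos M x y)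
    have h4 := mul_nonneg hA (tailFun_nonneg ρ M y)
    linarith

/-- The probability measure on `ℕ` associated with a probability mass function. -/
noncomputable def pmfNat (p : ℕ → ℝ) : Measure ℕ :=
  Measure.sum fun n => ENNReal.ofReal (p n) • Measure.dirac n

/-- The cumulative distribution function of a probability mass function on `ℕ`. -/
def pmfCdf (p : ℕ → ℝ) (j : ℕ) : ℝ := ∑ k ∈ Finset.range (j + 1), p k

lemma map_cast_pmfNat (p : ℕ → ℝ) : (pmfNat p).map (Nat.cast : ℕ → ℝ) = pmfMeasure p := by
  unfold pmfNat pmfMeasure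
  rw [Measure.map_sum measurable_from_top.aemeasurable]
  congr 1
  ext1 n
  rw [Measure.map_smul, Measure.map_dirac' measurable_from_top]

lemma map_floor_pmfMeasure (p : ℕ → ℝ) : (pmfMeasure p).map Nat.floor = pmfNat p := by
  rw [← map_cast_pmfNat, Measure.map_map Nat.measurable_floor measurable_from_top]
  convert! Measure.map_id
  ext1 n
  simp

lemma ae_pmfMeasure_eq_floor (p : ℕ → ℝ) : ∀ᵐ x ∂pmfMeasure p, ((⌊x⌋₊ : ℕ) : ℝ) = x := by
  rw [← map_cast_pmfNat, ae_map_iff measurable_from_top.aemeasurable]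
  · simp
  · exact measurableSet_eq_fun (by fun_prop) measurable_id

lemma isProbabilityMeasure_pmfNat {p : ℕ → ℝ} (hp0 : ∀ x, 0 ≤ p x) (hp1 : HasSum p 1) :
    IsProbabilityMeasure (pmfNat p) := by
  constructor
  unfold pmfNat
  rw [Measure.sum_apply _ MeasurableSet.univ]
  simp only [Measure.smul_apply, measure_univ, smul_eq_mul, mul_one]
  rw [← ENNReal.ofReal_tsum_of_nonneg hp0 hp1.summable, hp1.tsum_eq, ENNReal.ofReal_one]

lemma integrable_pmfNat {p : ℕ → ℝ} (hp0 : ∀ x, 0 ≤ p x) {f : ℕ → ℝ}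
    (hf : Summable fun n => p n * |f n|) : Integrable f (pmfNat p) := by
  unfold pmfNat
  rw [integrable_sum_dirac_iff (by simp)]
  simpa [ENNReal.toReal_ofReal (hp0 _)] using hf

lemma integral_pmfNat {p : ℕ → ℝ} (hp0 : ∀ x, 0 ≤ p x) (f : ℕ → ℝ) :
    ∫ x, f x ∂pmfNat p = ∑' n, p n * f n := by
  unfold pmfNat
  rw [integral_sum_dirac (by simp)]
  simp [ENNReal.toReal_ofReal (hp0 _)]

lemma IsCoupling.swap {E : Type*} [MeasurableSpace E] {π : Measure (E × E)} {P Q : Measure E}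
    (h : IsCoupling π P Q) : IsCoupling (π.map Prod.swap) Q P := by
  constructor
  · rw [Measure.map_map measurable_fst measurable_swap]
    exact h.2
  · rw [Measure.map_map measurable_snd measurable_swap]
    exact h.1

lemma IsCoupling.integrable_fst {π : Measure (ℕ × ℕ)} {p : ℕ → ℝ} {Q : Measure ℕ}
    (hπ : IsCoupling π (pmfNat p) Q) (hp0 : ∀ x, 0 ≤ p x) {f : ℕ → ℝ}
    (hf : Summable fun n => p n * |f n|) : Integrable (fun z => f z.1) π :=
  (hπ.1 ▸ integrable_pmfNat hp0 hf).comp_measurable measurable_fst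

lemma IsCoupling.integrable_snd {π : Measure (ℕ × ℕ)} {q : ℕ → ℝ} {P : Measure ℕ}
    (hπ : IsCoupling π P (pmfNat q)) (hq0 : ∀ x, 0 ≤ q x) {f : ℕ → ℝ}
    (hf : Summable fun n => q n * |f n|) : Integrable (fun z => f z.2) π :=
  (hπ.2 ▸ integrable_pmfNat hq0 hf).comp_measurable measurable_snd

lemma IsCoupling.integral_fst {π : Measure (ℕ × ℕ)} {p : ℕ → ℝ} {Q : Measure ℕ}
    (hπ : IsCoupling π (pmfNat p) Q) (hp0 : ∀ x, 0 ≤ p x) (f : ℕ → ℝ) :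
    ∫ z, f z.1 ∂π = ∑' n, p n * f n := by
  rw [← integral_pmfNat hp0, ← hπ.1,
    integral_map measurable_fst.aemeasurable measurable_from_top.aestronglyMeasurable]

lemma IsCoupling.integral_snd {π : Measure (ℕ × ℕ)} {q : ℕ → ℝ} {P : Measure ℕ}
    (hπ : IsCoupling π P (pmfNat q)) (hq0 : ∀ x, 0 ≤ q x) (f : ℕ → ℝ) :
    ∫ z, f z.2 ∂π = ∑' n, q n * f n := by
  rw [← integral_pmfNat hq0, ← hπ.2,
    integral_map measurable_snd.aemeasurable measurable_from_top.aestronglyMeasurable]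

lemma hasSum_mul_lowerInd (p : ℕ → ℝ) (j : ℕ) :
    HasSum (fun n => p n * lowerInd j n) (pmfCdf p j) := by
  have h : HasSum (fun n => p n * lowerInd j n)
      (∑ n ∈ Finset.range (j + 1), p n * lowerInd j n) :=
    hasSum_sum_of_ne_finset_zero (fun n hn => by
      have : ¬ n ≤ j := by simpa [Nat.lt_succ_iff] using hn
      simp [lowerInd, this])
  convert h using 1
  refine Finset.sum_congr rfl fun n hn => ?_
  have : n ≤ j := by simpa [Nat.lt_succ_iff] using hn
  simp [lowerInd, this]

lemma hasSum_mul_bdGen_lowerInd (η ν p : ℕ → ℝ) (j : ℕ) :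
    HasSum (fun n => p n * bdGen η ν (lowerInd j) n) (-(η j * p j) + ν (j + 1) * p (j + 1)) := by
  have h1 : HasSum (fun n => if n = j then -(η j * p j) else 0) (-(η j * p j)) :=
    hasSum_ite_eq j _
  have h2 : HasSum (fun n => if n = j + 1 then ν (j + 1) * p (j + 1) else 0)
      (ν (j + 1) * p (j + 1)) := hasSum_ite_eq (j + 1) _
  convert! h1.add h2 using 2 with n
  rw [bdGen_lowerInd]
  split_ifs with h h' h'
  · omega
  · subst h; ring
  · subst h'; ring
  · ring

lemma pmfNat_Iic {p : ℕ → ℝ} (hp0 : ∀ x, 0 ≤ p x) (j : ℕ) :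
    pmfNat p (Set.Iic j) = ENNReal.ofReal (pmfCdf p j) := by
  unfold pmfNat pmfCdf
  rw [Measure.sum_apply _ measurableSet_Iic, ENNReal.ofReal_sum_of_nonneg fun i _ => hp0 i,
    tsum_eq_sum (s := Finset.range (j + 1))]
  · refine Finset.sum_congr rfl fun n hn => ?_
    have : n ≤ j := by simpa [Nat.lt_succ_iff] using hn
    simp [this]
  · intro n hn
    have : ¬ n ≤ j := by simpa [Nat.lt_succ_iff] using hn
    simp [this]

lemma pmfCdf_mono {p : ℕ → ℝ} (hp0 : ∀ x, 0 ≤ p x) : Monotone (pmfCdf p) := by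
  intro i j h
  exact Finset.sum_le_sum_of_subset_of_nonneg (by simpa using h) fun k _ _ => hp0 k

lemma pmfCdf_le_one {p : ℕ → ℝ} (hp0 : ∀ x, 0 ≤ p x) (hp1 : HasSum p 1) (j : ℕ) :
    pmfCdf p j ≤ 1 := sum_le_hasSum _ (fun k _ => hp0 k) hp1

/-- Quantile transform: a pmf on `ℕ` is the law of a function of a uniform variable. -/
lemma exists_quantile {p : ℕ → ℝ} (hp0 : ∀ x, 0 ≤ p x) (hp1 : HasSum p 1) :
    ∃ X : ℝ → ℕ, Measurable X ∧ (volume.restrict (Set.Ico (0 : ℝ) 1)).map X = pmfNat p ∧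
      ∀ u < 1, ∀ j, X u ≤ j ↔ u < pmfCdf p j := by
  classical
  have hlim : Filter.Tendsto (pmfCdf p) Filter.atTop (nhds 1) :=
    (hp1.tendsto_sum_nat.comp (Filter.tendsto_add_atTop_nat 1))
  have hex : ∀ u : ℝ, ∃ n, u < pmfCdf p n ∨ 1 ≤ u := by
    intro u
    rcases lt_or_ge u 1 with h | h
    · obtain ⟨n, hn⟩ := (hlim.eventually_const_lt h).exists
      exact ⟨n, Or.inl hn⟩
    · exact ⟨0, Or.inr h⟩
  have hmeas : Measurable fun u => Nat.find (hex u) :=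
    measurable_find hex fun k => (measurableSet_Iio (a := pmfCdf p k)).union
      (measurableSet_Ici (a := (1 : ℝ)))
  have hiff : ∀ u < 1, ∀ j, Nat.find (hex u) ≤ j ↔ u < pmfCdf p j := by
    intro u hu j
    rw [Nat.find_le_iff]
    constructor
    · rintro ⟨m, hm, h | h⟩
      · exact h.trans_le (pmfCdf_mono hp0 hm)
      · exact absurd h (not_le.2 hu)
    · exact fun h => ⟨j, le_rfl, Or.inl h⟩
  refine ⟨fun u => Nat.find (hex u), hmeas, ?_, hiff⟩
  have := isProbabilityMeasure_pmfNat hp0 hp1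
  refine Measure.ext_of_Iic _ _ fun j => ?_
  rw [Measure.map_apply hmeas measurableSet_Iic, pmfNat_Iic hp0,
    Measure.restrict_apply (hmeas measurableSet_Iic)]
  have : (fun u => Nat.find (hex u)) ⁻¹' Set.Iic j ∩ Set.Ico 0 1 = Set.Ico 0 (pmfCdf p j) := by
    ext u
    simp only [Set.mem_inter_iff, Set.mem_preimage, Set.mem_Iic, Set.mem_Ico]
    constructor
    · rintro ⟨h, h0, h1⟩
      exact ⟨h0, (hiff u h1 j).1 h⟩
    · rintro ⟨h0, h⟩
      have h1 := h.trans_le (pmfCdf_le_one hp0 hp1 j)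
      exact ⟨(hiff u h1 j).2 h, h0, h1⟩
  rw [this, Real.volume_Ico, sub_zero]

/-- The comonotone coupling of two probability mass functions on `ℕ`. -/
lemma exists_comonotone_coupling {p q : ℕ → ℝ} (hp0 : ∀ x, 0 ≤ p x) (hp1 : HasSum p 1)
    (hq0 : ∀ x, 0 ≤ q x) (hq1 : HasSum q 1) :
    ∃ π : Measure (ℕ × ℕ), IsCoupling π (pmfNat p) (pmfNat q) ∧ ∀ᵐ z ∂π, ∀ i j,
      (z.1 ≤ j → i < z.2 → pmfCdf q i < pmfCdf p j) ∧
      (z.2 ≤ i → j < z.1 → pmfCdf p j < pmfCdf q i) := by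
  obtain ⟨X, hX, hXp, hX'⟩ := exists_quantile hp0 hp1
  obtain ⟨Y, hY, hYq, hY'⟩ := exists_quantile hq0 hq1
  refine ⟨(volume.restrict (Set.Ico (0 : ℝ) 1)).map fun u => (X u, Y u), ⟨?_, ?_⟩, ?_⟩
  · rw [Measure.map_map measurable_fst (hX.prodMk hY)]
    exact hXp
  · rw [Measure.map_map measurable_snd (hX.prodMk hY)]
    exact hYq
  · rw [ae_map_iff (hX.prodMk hY).aemeasurable (Set.to_countable _).measurableSet]
    filter_upwards [ae_restrict_mem measurableSet_Ico] with u hu i j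
    rw [hX' u hu.2 j, ← not_le, ← not_le, ← not_le, ← not_le, hY' u hu.2 i, hX' u hu.2 j,
      not_le, not_lt, not_le, not_lt]
    exact ⟨fun h1 h2 => h2.trans_lt h1, fun h1 h2 => h2.trans_lt h1⟩

lemma IsCoupling.isProbabilityMeasure {π : Measure (ℕ × ℕ)} {p : ℕ → ℝ} {Q : Measure ℕ}
    (hπ : IsCoupling π (pmfNat p) Q) (hp0 : ∀ x, 0 ≤ p x) (hp1 : HasSum p 1) :
    IsProbabilityMeasure π := by
  have := isProbabilityMeasure_pmfNat hp0 hp1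
  constructor
  rw [← measure_univ (μ := pmfNat p), ← hπ.1, Measure.map_apply measurable_fst MeasurableSet.univ,
    Set.preimage_univ]

lemma IsBDMarginal.hasDerivWithinAt_pmfCdf {η ν : ℕ → ℝ} {p : ℝ → ℕ → ℝ}
    (hp : IsBDMarginal η ν p) (hν : ν 0 = 0) (j : ℕ) {t : ℝ} (ht : 0 ≤ t) :
    HasDerivWithinAt (fun s => pmfCdf (p s) j) (-(η j * p t j) + ν (j + 1) * p t (j + 1))
      (Set.Ici 0) t := by
  induction j with
  | zero =>
    have h := hp.2 0 t ht
    simp only [if_true, hν, zero_add, add_zero] at h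
    simp only [pmfCdf, Finset.range_one, Finset.sum_singleton, zero_add]
    convert h using 1
    ring
  | succ j ih =>
    have h := ih.add (hp.2 (j + 1) t ht)
    simp only [pmfCdf] at h ⊢
    simp_rw [Finset.sum_range_succ _ (j + 1)]
    convert! h using 1
    simp only [Nat.add_eq_zero_iff, one_ne_zero, and_false, if_false, Nat.add_sub_cancel]
    ring

lemma sub_sum_mul_pmfCdf (g p : ℕ → ℝ) (N : ℕ) :
    g N - ∑ x ∈ Finset.range N, (g (x + 1) - g x) * pmfCdf p x
      = ∑ x ∈ Finset.range N, p x * g x + g N * (1 - ∑ x ∈ Finset.range N, p x) := by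
  induction N with
  | zero => simp
  | succ N ih =>
    rw [Finset.sum_range_succ, Finset.sum_range_succ _ N, Finset.sum_range_succ _ N, pmfCdf,
      Finset.sum_range_succ _ N]
    linear_combination ih

lemma mul_one_sub_sum_le_tsum {g p : ℕ → ℝ} (hg : Monotone g) (hp0 : ∀ x, 0 ≤ p x)
    (hp1 : HasSum p 1) (hs : Summable fun n => p n * g n) (N : ℕ) :
    ∑ x ∈ Finset.range N, p x * g x + g N * (1 - ∑ x ∈ Finset.range N, p x)
      ≤ ∑' n, p n * g n := by
  have h1 := hp1.summable.sum_add_tsum_nat_add N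
  rw [hp1.tsum_eq] at h1
  have h2 : 1 - ∑ x ∈ Finset.range N, p x = ∑' n, p (n + N) := by linarith
  rw [h2, ← hs.sum_add_tsum_nat_add N, ← tsum_mul_left]
  refine add_le_add le_rfl (Summable.tsum_le_tsum (fun n => ?_)
    (((summable_nat_add_iff N).2 hp1.summable).mul_left _) ((summable_nat_add_iff N).2 hs))
  rw [mul_comm]
  exact mul_le_mul_of_nonneg_left (hg (by omega)) (hp0 _)

lemma IsBDMarginal.moment_bound {η ν : ℕ → ℝ} {p : ℝ → ℕ → ℝ} (hp : IsBDMarginal η ν p)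
    (hν0 : ∀ x, 0 ≤ ν x) (hν : ν 0 = 0) {C L : ℝ} (hC : 0 ≤ C)
    (hη : ∀ x : ℕ, η x ≤ C * (1 + x)) {g : ℕ → ℝ} (hg0 : ∀ x, 0 ≤ g x) (hg : Monotone g)
    (hLg : ∀ x : ℕ, (1 + x) * (g (x + 1) - g x) ≤ L * g x) (hL : 0 ≤ L)
    (hs : Summable fun n => p 0 n * g n) {t : ℝ} (ht : 0 ≤ t) :
    (Summable fun n => p t n * g n) ∧
      ∑' n, p t n * g n ≤ Real.exp (C * L * t) * ∑' n, p 0 n * g n := by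
  have key : ∀ N, ∑ x ∈ Finset.range N, p t x * g x
      ≤ Real.exp (C * L * t) * ∑' n, p 0 n * g n := by
    intro N
    have htail : ∀ s, 0 ≤ s → 0 ≤ g N * (1 - ∑ x ∈ Finset.range N, p s x) := fun s h =>
      mul_nonneg (hg0 N) (sub_nonneg.2
        (sum_le_hasSum _ (fun k _ => (hp.1 s h).1 k) (hp.1 s h).2))
    have hder : ∀ s, 0 ≤ s → HasDerivWithinAt
        (fun s => g N - ∑ x ∈ Finset.range N, (g (x + 1) - g x) * pmfCdf (p s) x)
        (-∑ x ∈ Finset.range N, (g (x + 1) - g x) *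
          (-(η x * p s x) + ν (x + 1) * p s (x + 1))) (Set.Ici 0) s := fun s h =>
      (HasDerivWithinAt.fun_sum fun x _ =>
        (hp.hasDerivWithinAt_pmfCdf hν x h).const_mul _).const_sub _
    have h := le_exp_mul_of_deriv_right_le (T := t) (a := -(C * L))
      (B := fun _ => ∑' n, p 0 n * g n) (B' := fun _ => 0)
      (fun s h => ((hder s h.1).continuousWithinAt).mono Set.Icc_subset_Ici_self)
      (fun s h => (hder s h.1).mono (Set.Ici_subset_Ici.2 h.1))
      (fun s => hasDerivAt_const s _)
      (by
        rw [sub_sum_mul_pmfCdf]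
        exact mul_one_sub_sum_le_tsum hg (hp.1 0 le_rfl).1 (hp.1 0 le_rfl).2 hs N)
      (fun s h => by
        rw [sub_sum_mul_pmfCdf, mul_zero, add_zero, neg_neg, ← Finset.sum_neg_distrib]
        have h1 : ∑ x ∈ Finset.range N, -((g (x + 1) - g x) *
            (-(η x * p s x) + ν (x + 1) * p s (x + 1)))
              ≤ ∑ x ∈ Finset.range N, C * L * (p s x * g x) := by
          refine Finset.sum_le_sum fun x _ => ?_
          have hd : 0 ≤ g (x + 1) - g x := sub_nonneg.2 (hg (Nat.le_succ x))
          have hp0 := (hp.1 s h.1).1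
          have h2 := mul_nonneg hd (mul_nonneg (hν0 (x + 1)) (hp0 (x + 1)))
          have h3 := mul_le_mul_of_nonneg_right (hη x) (mul_nonneg hd (hp0 x))
          have h4 := mul_le_mul_of_nonneg_right (hLg x) (mul_nonneg hC (hp0 x))
          linarith
        rw [← Finset.mul_sum] at h1
        have := mul_nonneg (mul_nonneg hC hL) (htail s h.1)
        linarith) t ⟨ht, le_rfl⟩
    simp only [neg_neg] at h
    rw [sub_sum_mul_pmfCdf] at h
    linarith [htail t ht]
  have hnn : ∀ n, 0 ≤ p t n * g n := fun n => mul_nonneg ((hp.1 t ht).1 n) (hg0 n)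
  exact ⟨summable_of_sum_range_le hnn key, Real.tsum_le_of_sum_range_le hnn key⟩

/-- The optimal transport cost for the truncated cost, in terms of distribution functions. -/
noncomputable def truncTransport (r : ℝ) (M : ℕ) (p q : ℕ → ℝ) : ℝ :=
  ∑ j ∈ Finset.range M, ∑ i ∈ Finset.range (j + 1), costWeight r (j - i) *
    (max (pmfCdf q i - pmfCdf p j) 0 + max (pmfCdf p i - pmfCdf q j) 0)

lemma lowerInd_nonneg (j x : ℕ) : 0 ≤ lowerInd j x := by
  unfold lowerInd; split_ifs <;> norm_num

lemma lowerInd_le_one (j x : ℕ) : lowerInd j x ≤ 1 := by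
  unfold lowerInd; split_ifs <;> norm_num

lemma integrable_quadrant (π : Measure (ℕ × ℕ)) [IsFiniteMeasure π] (i j : ℕ) :
    Integrable (fun z : ℕ × ℕ => lowerInd i z.2 * (1 - lowerInd j z.1)) π := by
  refine Integrable.of_bound (Measurable.of_discrete).aestronglyMeasurable 1 ?_
  refine Filter.Eventually.of_forall fun z => ?_
  unfold lowerInd
  split_ifs <;> norm_num

lemma integrable_quadrant_swap (π : Measure (ℕ × ℕ)) [IsFiniteMeasure π] (i j : ℕ) :
    Integrable (fun z : ℕ × ℕ => lowerInd i z.1 * (1 - lowerInd j z.2)) π := by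
  refine Integrable.of_bound (Measurable.of_discrete).aestronglyMeasurable 1 ?_
  refine Filter.Eventually.of_forall fun z => ?_
  unfold lowerInd
  split_ifs <;> norm_num

lemma integral_truncCost (π : Measure (ℕ × ℕ)) [IsFiniteMeasure π] (r : ℝ) (M : ℕ) :
    ∫ z, truncCost r M z.1 z.2 ∂π
      = ∑ j ∈ Finset.range M, ∑ i ∈ Finset.range (j + 1), costWeight r (j - i) *
        (∫ z, lowerInd i z.2 * (1 - lowerInd j z.1) ∂π
          + ∫ z, lowerInd i z.1 * (1 - lowerInd j z.2) ∂π) := by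
  unfold truncCost
  have hint : ∀ i j : ℕ, Integrable (fun z : ℕ × ℕ => costWeight r (j - i) *
      (lowerInd i z.2 * (1 - lowerInd j z.1) + lowerInd i z.1 * (1 - lowerInd j z.2))) π :=
    fun i j => ((integrable_quadrant π i j).add (integrable_quadrant_swap π i j)).const_mul _
  rw [integral_finsetSum _ fun j _ => integrable_finsetSum _ fun i _ => hint i j]
  refine Finset.sum_congr rfl fun j _ => ?_
  rw [integral_finsetSum _ fun i _ => hint i j]
  refine Finset.sum_congr rfl fun i _ => ?_
  rw [integral_const_mul,
    integral_add (integrable_quadrant π i j) (integrable_quadrant_swap π i j)]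

lemma integrable_truncCost (π : Measure (ℕ × ℕ)) [IsFiniteMeasure π] (r : ℝ) (M : ℕ) :
    Integrable (fun z : ℕ × ℕ => truncCost r M z.1 z.2) π := by
  unfold truncCost
  exact integrable_finsetSum _ fun j _ => integrable_finsetSum _ fun i _ =>
    ((integrable_quadrant π i j).add (integrable_quadrant_swap π i j)).const_mul _

lemma IsCoupling.integral_lowerInd_sub {p q : ℕ → ℝ} (hp0 : ∀ x, 0 ≤ p x) (hq0 : ∀ x, 0 ≤ q x)
    {π : Measure (ℕ × ℕ)} (hπ : IsCoupling π (pmfNat p) (pmfNat q)) (i j : ℕ) :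
    Integrable (fun z : ℕ × ℕ => lowerInd i z.2 - lowerInd j z.1) π ∧
    ∫ z, (lowerInd i z.2 - lowerInd j z.1) ∂π = pmfCdf q i - pmfCdf p j := by
  have h1 : Integrable (fun z : ℕ × ℕ => lowerInd i z.2) π :=
    hπ.integrable_snd hq0 (by
      simpa only [abs_of_nonneg (lowerInd_nonneg _ _)] using (hasSum_mul_lowerInd q i).summable)
  have h2 : Integrable (fun z : ℕ × ℕ => lowerInd j z.1) π :=
    hπ.integrable_fst hp0 (by
      simpa only [abs_of_nonneg (lowerInd_nonneg _ _)] using (hasSum_mul_lowerInd p j).summable)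
  refine ⟨h1.sub h2, ?_⟩
  rw [integral_sub h1 h2, hπ.integral_snd hq0, hπ.integral_fst hp0,
    (hasSum_mul_lowerInd q i).tsum_eq, (hasSum_mul_lowerInd p j).tsum_eq]

lemma IsCoupling.max_pmfCdf_le {p q : ℕ → ℝ} (hp0 : ∀ x, 0 ≤ p x) (hq0 : ∀ x, 0 ≤ q x)
    {π : Measure (ℕ × ℕ)} [IsFiniteMeasure π] (hπ : IsCoupling π (pmfNat p) (pmfNat q))
    (i j : ℕ) :
    max (pmfCdf q i - pmfCdf p j) 0 ≤ ∫ z, lowerInd i z.2 * (1 - lowerInd j z.1) ∂π := by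
  obtain ⟨h1, h2⟩ := hπ.integral_lowerInd_sub hp0 hq0 i j
  refine max_le ?_ (integral_nonneg fun z =>
    mul_nonneg (lowerInd_nonneg _ _) (sub_nonneg.2 (lowerInd_le_one _ _)))
  rw [← h2]
  refine integral_mono h1 (integrable_quadrant π i j) fun z => ?_
  nlinarith [lowerInd_nonneg j z.1, lowerInd_le_one i z.2]

lemma IsCoupling.max_pmfCdf_eq {p q : ℕ → ℝ} (hp0 : ∀ x, 0 ≤ p x) (hq0 : ∀ x, 0 ≤ q x)
    {π : Measure (ℕ × ℕ)} [IsFiniteMeasure π] (hπ : IsCoupling π (pmfNat p) (pmfNat q))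
    (hmono : ∀ᵐ z ∂π, ∀ i j, (z.1 ≤ j → i < z.2 → pmfCdf q i < pmfCdf p j) ∧
      (z.2 ≤ i → j < z.1 → pmfCdf p j < pmfCdf q i)) (i j : ℕ) :
    ∫ z, lowerInd i z.2 * (1 - lowerInd j z.1) ∂π = max (pmfCdf q i - pmfCdf p j) 0 := by
  refine le_antisymm ?_ (hπ.max_pmfCdf_le hp0 hq0 i j)
  obtain ⟨h1, h2⟩ := hπ.integral_lowerInd_sub hp0 hq0 i j
  rcases le_or_gt (pmfCdf q i) (pmfCdf p j) with h | h
  · refine le_max_of_le_right (le_of_eq (integral_eq_zero_of_ae ?_))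
    filter_upwards [hmono] with z hz
    unfold lowerInd
    split_ifs with h3 h4 <;> norm_num
    exact absurd ((hz i j).2 h3 (not_le.1 h4)) (not_lt.2 h)
  · refine le_max_of_le_left ?_
    rw [← h2]
    refine integral_mono_ae (integrable_quadrant π i j) h1 ?_
    filter_upwards [hmono] with z hz
    unfold lowerInd
    split_ifs with h3 h4 h4 <;> norm_num
    exact absurd ((hz i j).1 h4 (not_le.1 h3)) (not_lt.2 h.le)

lemma integral_map_swap {π : Measure (ℕ × ℕ)} (f : ℕ × ℕ → ℝ) :
    ∫ z, f z ∂π.map Prod.swap = ∫ z, f z.swap ∂π :=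
  integral_map measurable_swap.aemeasurable (Measurable.of_discrete).aestronglyMeasurable

lemma IsCoupling.truncTransport_le {p q : ℕ → ℝ} (hp0 : ∀ x, 0 ≤ p x) (hq0 : ∀ x, 0 ≤ q x)
    {π : Measure (ℕ × ℕ)} [IsFiniteMeasure π] (hπ : IsCoupling π (pmfNat p) (pmfNat q))
    {r : ℝ} (hr : 1 ≤ r) (M : ℕ) :
    truncTransport r M p q ≤ ∫ z, truncCost r M z.1 z.2 ∂π := by
  rw [integral_truncCost]
  refine Finset.sum_le_sum fun j _ => Finset.sum_le_sum fun i _ =>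
    mul_le_mul_of_nonneg_left (add_le_add (hπ.max_pmfCdf_le hp0 hq0 i j) ?_)
      (costWeight_nonneg hr _)
  exact (hπ.swap.max_pmfCdf_le hq0 hp0 i j).trans_eq (integral_map_swap _)

lemma comonotone_swap {F G : ℕ → ℝ} {π : Measure (ℕ × ℕ)}
    (hmono : ∀ᵐ z ∂π, ∀ i j, (z.1 ≤ j → i < z.2 → G i < F j) ∧ (z.2 ≤ i → j < z.1 → F j < G i)) :
    ∀ᵐ z ∂π.map Prod.swap, ∀ i j,
      (z.1 ≤ j → i < z.2 → F i < G j) ∧ (z.2 ≤ i → j < z.1 → G j < F i) := by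
  rw [ae_map_iff measurable_swap.aemeasurable (Set.to_countable _).measurableSet]
  filter_upwards [hmono] with z hz i j
  exact ⟨(hz j i).2, (hz j i).1⟩

lemma IsCoupling.truncTransport_eq {p q : ℕ → ℝ} (hp0 : ∀ x, 0 ≤ p x) (hq0 : ∀ x, 0 ≤ q x)
    {π : Measure (ℕ × ℕ)} [IsFiniteMeasure π] (hπ : IsCoupling π (pmfNat p) (pmfNat q))
    (hmono : ∀ᵐ z ∂π, ∀ i j, (z.1 ≤ j → i < z.2 → pmfCdf q i < pmfCdf p j) ∧
      (z.2 ≤ i → j < z.1 → pmfCdf p j < pmfCdf q i)) (r : ℝ) (M : ℕ) :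
    ∫ z, truncCost r M z.1 z.2 ∂π = truncTransport r M p q := by
  rw [integral_truncCost]
  refine Finset.sum_congr rfl fun j _ => Finset.sum_congr rfl fun i _ => ?_
  rw [hπ.max_pmfCdf_eq hp0 hq0 hmono i j,
    ← hπ.swap.max_pmfCdf_eq hq0 hp0 (comonotone_swap hmono) i j, integral_map_swap]
  rfl

lemma bdCouplingGen_truncCost (η ν : ℕ → ℝ) (r : ℝ) (M x y : ℕ) :
    bdCouplingGen η ν (truncCost r M) x y
      = ∑ j ∈ Finset.range M, ∑ i ∈ Finset.range (j + 1), costWeight r (j - i) *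
        (bdCouplingGen η ν (fun x y => lowerInd i y * (1 - lowerInd j x)) x y
          + bdCouplingGen η ν (fun x y => lowerInd i x * (1 - lowerInd j y)) x y) := by
  have h1 := bdCouplingGen_sum (η := η) (ν := ν) (Finset.range M) (fun _ => 1)
    (fun j x y => ∑ i ∈ Finset.range (j + 1), costWeight r (j - i) *
    (lowerInd i y * (1 - lowerInd j x) + lowerInd i x * (1 - lowerInd j y))) x y
  simp only [one_mul] at h1
  unfold truncCost
  rw [h1]
  refine Finset.sum_congr rfl fun j _ => ?_
  rw [bdCouplingGen_sum]
  refine Finset.sum_congr rfl fun i _ => ?_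
  unfold bdCouplingGen
  ring

lemma IsCoupling.integral_bdGen_sub {p q : ℕ → ℝ} (hp0 : ∀ x, 0 ≤ p x) (hq0 : ∀ x, 0 ≤ q x)
    {π : Measure (ℕ × ℕ)} (hπ : IsCoupling π (pmfNat p) (pmfNat q)) {η ν : ℕ → ℝ}
    (i j : ℕ) :
    Integrable (fun z : ℕ × ℕ => bdGen η ν (lowerInd i) z.2 - bdGen η ν (lowerInd j) z.1) π ∧
    ∫ z, (bdGen η ν (lowerInd i) z.2 - bdGen η ν (lowerInd j) z.1) ∂π
      = (-(η i * q i) + ν (i + 1) * q (i + 1)) - (-(η j * p j) + ν (j + 1) * p (j + 1)) := by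
  have habs : ∀ p : ℕ → ℝ, (∀ x, 0 ≤ p x) → ∀ j,
      Summable fun n => p n * |bdGen η ν (lowerInd j) n| := by
    intro p hp0 j
    have := (hasSum_mul_bdGen_lowerInd η ν p j).summable.abs
    simpa only [abs_mul, abs_of_nonneg (hp0 _)] using this
  have h1 : Integrable (fun z : ℕ × ℕ => bdGen η ν (lowerInd i) z.2) π :=
    hπ.integrable_snd hq0 (habs q hq0 i)
  have h2 : Integrable (fun z : ℕ × ℕ => bdGen η ν (lowerInd j) z.1) π :=
    hπ.integrable_fst hp0 (habs p hp0 j)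
  refine ⟨h1.sub h2, ?_⟩
  rw [integral_sub h1 h2, hπ.integral_snd hq0, hπ.integral_fst hp0,
    (hasSum_mul_bdGen_lowerInd η ν q i).tsum_eq, (hasSum_mul_bdGen_lowerInd η ν p j).tsum_eq]

/-- The dissipation inequality for the truncated optimal transport cost. -/
lemma exists_hasDerivWithinAt_truncTransport {η ν : ℕ → ℝ} (hη0 : ∀ x, 0 ≤ η x)
    (hν0 : ∀ x, 0 ≤ ν x) (hν : ν 0 = 0) {p q : ℝ → ℕ → ℝ} (hp : IsBDMarginal η ν p)
    (hq : IsBDMarginal η ν q) {r a b A : ℝ} (hr : 1 ≤ r) {M : ℕ} {g : ℕ → ℝ}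
    (hg0 : ∀ x, 0 ≤ g x)
    (hgen : ∀ x y, bdCouplingGen η ν (truncCost r M) x y
      ≤ -a * truncCost r M x y + b * truncCost 1 M x y + A * (g x + g y))
    {t : ℝ} (ht : 0 ≤ t) (hsp : Summable fun n => p t n * g n)
    (hsq : Summable fun n => q t n * g n) :
    ∃ d, HasDerivWithinAt (fun s => truncTransport r M (p s) (q s)) d (Set.Ici t) t ∧
      d ≤ -a * truncTransport r M (p t) (q t) + b * truncTransport 1 M (p t) (q t)
        + A * (∑' n, p t n * g n + ∑' n, q t n * g n) := by
  have hp0 := (hp.1 t ht).1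
  have hq0 := (hq.1 t ht).1
  obtain ⟨π, hπ, hmono⟩ := exists_comonotone_coupling hp0 (hp.1 t ht).2 hq0 (hq.1 t ht).2
  have := hπ.isProbabilityMeasure hp0 (hp.1 t ht).2
  have hder : ∀ i j, HasDerivWithinAt (fun s => pmfCdf (q s) i - pmfCdf (p s) j)
      (∫ z, (bdGen η ν (lowerInd i) z.2 - bdGen η ν (lowerInd j) z.1) ∂π) (Set.Ici t) t := by
    intro i j
    rw [(hπ.integral_bdGen_sub hp0 hq0 i j).2]
    exact ((hq.hasDerivWithinAt_pmfCdf hν i ht).sub (hp.hasDerivWithinAt_pmfCdf hν j ht)).mono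
      (Set.Ici_subset_Ici.2 ht)
  have hder' : ∀ i j, HasDerivWithinAt (fun s => pmfCdf (p s) i - pmfCdf (q s) j)
      (∫ z, (bdGen η ν (lowerInd i) z.1 - bdGen η ν (lowerInd j) z.2) ∂π) (Set.Ici t) t := by
    intro i j
    have h := (hπ.swap.integral_bdGen_sub (η := η) (ν := ν) hq0 hp0 i j).2
    rw [integral_map_swap] at h
    simp only [Prod.snd_swap, Prod.fst_swap] at h
    rw [h]
    exact ((hp.hasDerivWithinAt_pmfCdf hν i ht).sub (hq.hasDerivWithinAt_pmfCdf hν j ht)).mono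
      (Set.Ici_subset_Ici.2 ht)
  have hint : ∀ i j, Integrable (fun z : ℕ × ℕ =>
      bdGen η ν (lowerInd i) z.2 - bdGen η ν (lowerInd j) z.1) π :=
    fun i j => (hπ.integral_bdGen_sub hp0 hq0 i j).1
  have hint' : ∀ i j, Integrable (fun z : ℕ × ℕ =>
      bdGen η ν (lowerInd i) z.1 - bdGen η ν (lowerInd j) z.2) π :=
    fun i j => (hπ.swap.integral_bdGen_sub hq0 hp0 i j).1.comp_measurable measurable_swap
  choose e he hed using fun i j => exists_hasDerivWithinAt_max_zero (hder i j)
  choose e' he' hed' using fun i j => exists_hasDerivWithinAt_max_zero (hder' i j)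
  have hterm : ∀ i j, Integrable (fun z : ℕ × ℕ => costWeight r (j - i) *
      (e i j * (bdGen η ν (lowerInd i) z.2 - bdGen η ν (lowerInd j) z.1)
        + e' i j * (bdGen η ν (lowerInd i) z.1 - bdGen η ν (lowerInd j) z.2))) π :=
    fun i j => (((hint i j).const_mul _).add ((hint' i j).const_mul _)).const_mul _
  have hgp : Integrable (fun z : ℕ × ℕ => g z.1) π := hπ.integrable_fst hp0 (by
    simpa only [abs_of_nonneg (hg0 _)] using hsp)
  have hgq : Integrable (fun z : ℕ × ℕ => g z.2) π := hπ.integrable_snd hq0 (by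
    simpa only [abs_of_nonneg (hg0 _)] using hsq)
  refine ⟨_, HasDerivWithinAt.fun_sum fun j _ => HasDerivWithinAt.fun_sum fun i _ =>
    ((hed i j).add (hed' i j)).const_mul _, ?_⟩
  calc _ = ∫ z, ∑ j ∈ Finset.range M, ∑ i ∈ Finset.range (j + 1), costWeight r (j - i) *
      (e i j * (bdGen η ν (lowerInd i) z.2 - bdGen η ν (lowerInd j) z.1)
        + e' i j * (bdGen η ν (lowerInd i) z.1 - bdGen η ν (lowerInd j) z.2)) ∂π := by
        rw [integral_finsetSum _ fun j _ => integrable_finsetSum _ fun i _ => hterm i j]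
        refine Finset.sum_congr rfl fun j _ => ?_
        rw [integral_finsetSum _ fun i _ => hterm i j]
        refine Finset.sum_congr rfl fun i _ => ?_
        rw [integral_const_mul, integral_add ((hint i j).const_mul _) ((hint' i j).const_mul _),
          integral_const_mul, integral_const_mul]
    _ ≤ ∫ z, (-a * truncCost r M z.1 z.2 + b * truncCost 1 M z.1 z.2 + A * (g z.1 + g z.2)) ∂π := by
        refine integral_mono_ae
          (integrable_finsetSum _ fun j _ => integrable_finsetSum _ fun i _ => hterm i j)
          ((((integrable_truncCost π r M).const_mul _).add
            ((integrable_truncCost π 1 M).const_mul _)).add ((hgp.add hgq).const_mul _)) ?_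
        filter_upwards [hmono] with z hz
        refine le_trans ?_ (hgen z.1 z.2)
        rw [bdCouplingGen_truncCost]
        refine Finset.sum_le_sum fun j _ => Finset.sum_le_sum fun i _ =>
          mul_le_mul_of_nonneg_left (add_le_add ?_ ?_) (costWeight_nonneg hr _)
        · exact mul_bdGen_lowerInd_le hη0 hν0 (he i j) (hz i j).1 (hz i j).2
        · rw [show bdCouplingGen η ν (fun x y => lowerInd i x * (1 - lowerInd j y)) z.1 z.2
            = bdCouplingGen η ν (fun x y => lowerInd i y * (1 - lowerInd j x)) z.2 z.1 by
              unfold bdCouplingGen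
              rw [min_comm (η z.1), min_comm (ν z.1)]
              ring]
          exact mul_bdGen_lowerInd_le hη0 hν0 (he' i j) (hz j i).2 (hz j i).1
    _ = _ := by
        rw [integral_add, integral_add, integral_const_mul, integral_const_mul,
          integral_const_mul, integral_add hgp hgq, hπ.integral_fst hp0, hπ.integral_snd hq0,
          hπ.truncTransport_eq hp0 hq0 hmono, hπ.truncTransport_eq hp0 hq0 hmono]
        · exact (integrable_truncCost π r M).const_mul _
        · exact (integrable_truncCost π 1 M).const_mul _
        · exact ((integrable_truncCost π r M).const_mul _).add
            ((integrable_truncCost π 1 M).const_mul _)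
        · exact (hgp.add hgq).const_mul _

lemma continuousOn_truncTransport {η ν : ℕ → ℝ} (hν : ν 0 = 0) {p q : ℝ → ℕ → ℝ}
    (hp : IsBDMarginal η ν p) (hq : IsBDMarginal η ν q) (r : ℝ) (M : ℕ) (T : ℝ) :
    ContinuousOn (fun s => truncTransport r M (p s) (q s)) (Set.Icc 0 T) := by
  have hc : ∀ p, IsBDMarginal η ν p → ∀ j,
      ContinuousOn (fun s => pmfCdf (p s) j) (Set.Icc 0 T) := fun p hp j s hs =>
    ((hp.hasDerivWithinAt_pmfCdf hν j hs.1).continuousWithinAt).mono Set.Icc_subset_Ici_self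
  unfold truncTransport
  refine continuousOn_finsetSum _ fun j _ => continuousOn_finsetSum _ fun i _ =>
    continuousOn_const.mul (ContinuousOn.add ?_ ?_)
  · exact ((hc q hq i).sub (hc p hp j)).sup continuousOn_const
  · exact ((hc p hp i).sub (hc q hq j)).sup continuousOn_const

lemma summable_mul_succ_rpow {p : ℕ → ℝ} (hp0 : ∀ x, 0 ≤ p x) (hp1 : HasSum p 1) {ρ : ℝ}
    (hρ : 0 ≤ ρ) (hm : Summable fun n : ℕ => (n : ℝ) ^ ρ * p n) :
    Summable fun n : ℕ => p n * ((n : ℝ) + 1) ^ ρ := by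
  refine Summable.of_nonneg_of_le (fun n => mul_nonneg (hp0 n) (by positivity)) (fun n => ?_)
    ((hm.add hp1.summable).mul_left (2 ^ ρ))
  have h2 : ((n : ℝ) + 1) ^ ρ ≤ 2 ^ ρ * ((n : ℝ) ^ ρ + 1) := by
    rcases Nat.eq_zero_or_pos n with rfl | hn
    · have := Real.one_le_rpow (x := 2) (by norm_num) hρ
      have h0 : 0 ≤ (0 : ℝ) ^ ρ := by positivity
      simp only [Nat.cast_zero, zero_add, Real.one_rpow]
      nlinarith
    · have hn' : (1 : ℝ) ≤ n := by exact_mod_cast hn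
      calc ((n : ℝ) + 1) ^ ρ ≤ (2 * n) ^ ρ := by gcongr; linarith
        _ = 2 ^ ρ * (n : ℝ) ^ ρ := Real.mul_rpow (by norm_num) (by positivity)
        _ ≤ _ := by gcongr; linarith
  calc p n * ((n : ℝ) + 1) ^ ρ ≤ p n * (2 ^ ρ * ((n : ℝ) ^ ρ + 1)) :=
        mul_le_mul_of_nonneg_left h2 (hp0 n)
    _ = _ := by ring

lemma summable_mul_tailFun {p : ℕ → ℝ} (hp0 : ∀ x, 0 ≤ p x) {ρ : ℝ}
    (hs : Summable fun n : ℕ => p n * ((n : ℝ) + 1) ^ ρ) (M : ℕ) :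
    Summable fun n => p n * tailFun ρ M n :=
  Summable.of_nonneg_of_le (fun n => mul_nonneg (hp0 n) (tailFun_nonneg ρ M n))
    (fun n => mul_le_mul_of_nonneg_left (tailFun_le ρ M n) (hp0 n)) hs

lemma tendsto_tsum_mul_tailFun {p : ℕ → ℝ} (hp0 : ∀ x, 0 ≤ p x) {ρ : ℝ}
    (hs : Summable fun n : ℕ => p n * ((n : ℝ) + 1) ^ ρ) :
    Filter.Tendsto (fun M => ∑' n, p n * tailFun ρ M n) Filter.atTop (nhds 0) := by
  have key : ∀ n, Filter.Tendsto (fun M => p n * tailFun ρ M n) Filter.atTop (nhds 0) := by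
    intro n
    have h1 : Filter.Tendsto (fun M : ℕ => ((n : ℝ) + 1) / ((M : ℝ) + 1)) Filter.atTop (nhds 0) :=
      tendsto_const_nhds.div_atTop
        (Filter.tendsto_atTop_add_const_right _ _ tendsto_natCast_atTop_atTop)
    have h2 := ((tendsto_const_nhds (x := (1 : ℝ))).min h1).const_mul (((n : ℝ) + 1) ^ ρ)
    simpa [tailFun] using h2.const_mul (p n)
  have := tendsto_tsum_of_dominated_convergence hs key
    (Filter.Eventually.of_forall fun M n => by
      rw [Real.norm_of_nonneg (mul_nonneg (hp0 n) (tailFun_nonneg ρ M n))]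
      exact mul_le_mul_of_nonneg_left (tailFun_le ρ M n) (hp0 n))
  simpa using this

lemma abs_sub_rpow_le {r ρ : ℝ} (hr : 0 ≤ r) (hrρ : r ≤ ρ) (x y : ℕ) :
    |(x : ℝ) - y| ^ r ≤ ((x : ℝ) + 1) ^ ρ + ((y : ℝ) + 1) ^ ρ := by
  have hx : (0 : ℝ) ≤ x := x.cast_nonneg
  have hy : (0 : ℝ) ≤ y := y.cast_nonneg
  have hpow : ∀ n : ℕ, ((n : ℝ) + 1) ^ r ≤ ((n : ℝ) + 1) ^ ρ := fun n =>
    Real.rpow_le_rpow_of_exponent_le (by simp) hrρ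
  have hnonneg : ∀ n : ℕ, 0 ≤ ((n : ℝ) + 1) ^ ρ := fun n => by positivity
  rcases le_total (x : ℝ) y with h | h
  · have : |(x : ℝ) - y| ≤ y + 1 := by rw [abs_of_nonpos (by linarith)]; linarith
    linarith [Real.rpow_le_rpow (abs_nonneg _) this hr, hpow y, hnonneg x]
  · have : |(x : ℝ) - y| ≤ x + 1 := by rw [abs_of_nonneg (by linarith)]; linarith
    linarith [Real.rpow_le_rpow (abs_nonneg _) this hr, hpow x, hnonneg y]

lemma IsCoupling.integrable_abs_sub_rpow {p q : ℕ → ℝ} (hp0 : ∀ x, 0 ≤ p x)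
    (hq0 : ∀ x, 0 ≤ q x) {π : Measure (ℕ × ℕ)} (hπ : IsCoupling π (pmfNat p) (pmfNat q))
    {r ρ : ℝ} (hr : 0 ≤ r) (hrρ : r ≤ ρ)
    (hp : Summable fun n : ℕ => p n * ((n : ℝ) + 1) ^ ρ)
    (hq : Summable fun n : ℕ => q n * ((n : ℝ) + 1) ^ ρ) :
    Integrable (fun z : ℕ × ℕ => |(z.1 : ℝ) - z.2| ^ r) π := by
  have habs : ∀ n : ℕ, |((n : ℝ) + 1) ^ ρ| = ((n : ℝ) + 1) ^ ρ := fun n =>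
    abs_of_nonneg (by positivity)
  have h1 := hπ.integrable_fst hp0 (f := fun n : ℕ => ((n : ℝ) + 1) ^ ρ) (by simpa [habs] using hp)
  have h2 := hπ.integrable_snd hq0 (f := fun n : ℕ => ((n : ℝ) + 1) ^ ρ) (by simpa [habs] using hq)
  refine (h1.add h2).mono' (Measurable.of_discrete).aestronglyMeasurable
    (Filter.Eventually.of_forall fun z => ?_)
  rw [Real.norm_of_nonneg (by positivity)]
  exact abs_sub_rpow_le hr hrρ z.1 z.2

lemma IsCoupling.map_natCast {p q : ℕ → ℝ} {π : Measure (ℕ × ℕ)}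
    (hπ : IsCoupling π (pmfNat p) (pmfNat q)) :
    IsCoupling (π.map (Prod.map (Nat.cast : ℕ → ℝ) (Nat.cast : ℕ → ℝ)))
      (pmfMeasure p) (pmfMeasure q) := by
  have hc : Measurable (Nat.cast : ℕ → ℝ) := measurable_from_top
  constructor
  · rw [Measure.map_map measurable_fst (hc.prodMap hc), ← map_cast_pmfNat, ← hπ.1,
      Measure.map_map hc measurable_fst]
    rfl
  · rw [Measure.map_map measurable_snd (hc.prodMap hc), ← map_cast_pmfNat, ← hπ.2,
      Measure.map_map hc measurable_snd]
    rfl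

lemma IsCoupling.map_floor {p q : ℕ → ℝ} {π : Measure (ℝ × ℝ)}
    (hπ : IsCoupling π (pmfMeasure p) (pmfMeasure q)) :
    IsCoupling (π.map (Prod.map (Nat.floor : ℝ → ℕ) (Nat.floor : ℝ → ℕ)))
      (pmfNat p) (pmfNat q) := by
  have hc : Measurable (Nat.floor : ℝ → ℕ) := Nat.measurable_floor
  constructor
  · rw [Measure.map_map measurable_fst (hc.prodMap hc), ← map_floor_pmfMeasure, ← hπ.1,
      Measure.map_map hc measurable_fst]
    rfl
  · rw [Measure.map_map measurable_snd (hc.prodMap hc), ← map_floor_pmfMeasure, ← hπ.2,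
      Measure.map_map hc measurable_snd]
    rfl

lemma truncTransport_le_wassersteinPow {p q : ℕ → ℝ} (hp0 : ∀ x, 0 ≤ p x) (hp1 : HasSum p 1)
    (hq0 : ∀ x, 0 ≤ q x) (hq1 : HasSum q 1) {r ρ : ℝ} (hr : 1 ≤ r) (hrρ : r ≤ ρ)
    (hp : Summable fun n : ℕ => p n * ((n : ℝ) + 1) ^ ρ)
    (hq : Summable fun n : ℕ => q n * ((n : ℝ) + 1) ^ ρ) (M : ℕ) :
    truncTransport r M p q ≤ wassersteinPow r (pmfMeasure p) (pmfMeasure q) := by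
  have hr0 : 0 < r := by linarith
  obtain ⟨π₀, hπ₀, -⟩ := exists_comonotone_coupling hp0 hp1 hq0 hq1
  refine le_csInf ⟨_, _, hπ₀.map_natCast, rfl⟩ ?_
  rintro c ⟨π, hπ, rfl⟩
  have hfl := hπ.map_floor
  have := hfl.isProbabilityMeasure hp0 hp1
  have hint := hfl.integrable_abs_sub_rpow hp0 hq0 hr0.le hrρ hp hq
  calc truncTransport r M p q ≤ _ := hfl.truncTransport_le hp0 hq0 hr M
    _ ≤ ∫ z, |(z.1 : ℝ) - z.2| ^ r ∂π.map (Prod.map (Nat.floor : ℝ → ℕ) (Nat.floor : ℝ → ℕ)) :=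
        integral_mono (integrable_truncCost _ r M) hint fun z => truncCost_le hr0 M z.1 z.2
    _ = ∫ z, |((⌊z.1⌋₊ : ℕ) : ℝ) - (⌊z.2⌋₊ : ℕ)| ^ r ∂π :=
        integral_map (Nat.measurable_floor.prodMap Nat.measurable_floor).aemeasurable
          hint.aestronglyMeasurable
    _ = ∫ z, ‖z.1 - z.2‖ ^ r ∂π := by
        have h1 : ∀ᵐ z ∂π, ((⌊z.1⌋₊ : ℕ) : ℝ) = z.1 :=
          ae_of_ae_map measurable_fst.aemeasurable (hπ.1 ▸ ae_pmfMeasure_eq_floor p)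
        have h2 : ∀ᵐ z ∂π, ((⌊z.2⌋₊ : ℕ) : ℝ) = z.2 :=
          ae_of_ae_map measurable_snd.aemeasurable (hπ.2 ▸ ae_pmfMeasure_eq_floor q)
        refine integral_congr_ae ?_
        filter_upwards [h1, h2] with z hz1 hz2
        rw [hz1, hz2, Real.norm_eq_abs]

lemma wassersteinPow_le_of_truncTransport_le {p q : ℕ → ℝ} (hp0 : ∀ x, 0 ≤ p x)
    (hp1 : HasSum p 1) (hq0 : ∀ x, 0 ≤ q x) (hq1 : HasSum q 1) {ρ : ℝ} (hρ : 1 ≤ ρ)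
    (hp : Summable fun n : ℕ => p n * ((n : ℝ) + 1) ^ ρ)
    (hq : Summable fun n : ℕ => q n * ((n : ℝ) + 1) ^ ρ) {b : ℕ → ℝ} {B : ℝ}
    (hb : Filter.Tendsto b Filter.atTop (nhds B)) (hle : ∀ M, truncTransport ρ M p q ≤ b M) :
    wassersteinPow ρ (pmfMeasure p) (pmfMeasure q) ≤ B := by
  have hρ0 : 0 < ρ := by linarith
  obtain ⟨π, hπ, hmono⟩ := exists_comonotone_coupling hp0 hp1 hq0 hq1
  have := hπ.isProbabilityMeasure hp0 hp1
  have hint := hπ.integrable_abs_sub_rpow hp0 hq0 hρ0.le le_rfl hp hq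
  have hcost : wassersteinPow ρ (pmfMeasure p) (pmfMeasure q)
      ≤ ∫ z, |(z.1 : ℝ) - z.2| ^ ρ ∂π := by
    refine csInf_le ⟨0, ?_⟩ ⟨_, hπ.map_natCast, ?_⟩
    · rintro c ⟨π', -, rfl⟩
      exact integral_nonneg fun z => by positivity
    · rw [integral_map]
      · rfl
      · exact ((measurable_from_top (f := (Nat.cast : ℕ → ℝ))).prodMap
          measurable_from_top).aemeasurable
      · exact ((measurable_fst.sub measurable_snd).norm.pow_const ρ).aestronglyMeasurable
  have hlim : Filter.Tendsto (fun M => ∫ z, truncCost ρ M z.1 z.2 ∂π) Filter.atTop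
      (nhds (∫ z, |(z.1 : ℝ) - z.2| ^ ρ ∂π)) := by
    refine tendsto_integral_of_dominated_convergence _
      (fun M => (integrable_truncCost π ρ M).aestronglyMeasurable) hint
      (fun M => Filter.Eventually.of_forall fun z => ?_)
      (Filter.Eventually.of_forall fun z => ?_)
    · rw [Real.norm_of_nonneg (truncCost_nonneg hρ0 M z.1 z.2)]
      exact truncCost_le hρ0 M z.1 z.2
    · refine tendsto_const_nhds.congr' ?_
      filter_upwards [Filter.eventually_ge_atTop (max z.1 z.2)] with M hM
      rw [truncCost_eq hρ0, min_eq_left (le_trans (le_max_left _ _) hM),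
        min_eq_left (le_trans (le_max_right _ _) hM)]
  refine hcost.trans (le_of_tendsto_of_tendsto' hlim hb fun M => ?_)
  rw [hπ.truncTransport_eq hp0 hq0 hmono]
  exact hle M

lemma le_exp_mul_of_exists_deriv_right_le {T a : ℝ} {f B B' : ℝ → ℝ}
    (hf : ContinuousOn f (Set.Icc 0 T)) (hB : ∀ t, HasDerivAt B (B' t) t) (h0 : f 0 ≤ B 0)
    (hd : ∀ t ∈ Set.Ico 0 T, ∃ d, HasDerivWithinAt f d (Set.Ici t) t ∧
      d ≤ -a * f t + Real.exp (-a * t) * B' t) :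
    ∀ t ∈ Set.Icc 0 T, f t ≤ Real.exp (-a * t) * B t := by
  choose! f' hf' hle using hd
  exact le_exp_mul_of_deriv_right_le hf hf' hB h0 hle

lemma le_exp_neg_mul_mul_exp_abs_mul {a t T δ : ℝ} (hδ : 0 ≤ δ) (ht : 0 ≤ t) (htT : t ≤ T) :
    δ ≤ Real.exp (-a * t) * (δ * Real.exp (|a| * T)) := by
  have h : 1 ≤ Real.exp (-a * t + |a| * T) := by
    refine Real.one_le_exp ?_
    nlinarith [le_abs_self a, abs_nonneg a, mul_le_mul_of_nonneg_right (le_abs_self a) ht,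
      mul_le_mul_of_nonneg_left htT (abs_nonneg a)]
  calc δ ≤ δ * Real.exp (-a * t + |a| * T) := le_mul_of_one_le_right hδ h
    _ = _ := by rw [Real.exp_add]; ring

lemma exists_hasDerivAt_exp (κ : ℝ) {ρ : ℝ} (hρ : 1 < ρ) :
    ∃ J : ℝ → ℝ, J 0 = 0 ∧ (∀ t, HasDerivAt J (Real.exp (κ * (ρ - 1) * t)) t) ∧
      ∀ t, Real.exp (-(κ * ρ) * t) * J t = if κ = 0 then t else
        (Real.exp (-κ * t) - Real.exp (-κ * ρ * t)) / (κ * (ρ - 1)) := by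
  by_cases hκ : κ = 0
  · exact ⟨id, rfl, fun t => by simpa [hκ] using hasDerivAt_id t, fun t => by simp [hκ]⟩
  · have hc : κ * (ρ - 1) ≠ 0 := mul_ne_zero hκ (by linarith)
    refine ⟨fun t => (Real.exp (κ * (ρ - 1) * t) - 1) / (κ * (ρ - 1)), by simp, fun t => ?_,
      fun t => ?_⟩
    · have h := (((hasDerivAt_id t).const_mul (κ * (ρ - 1))).exp.sub_const 1).div_const
        (κ * (ρ - 1))
      simpa [hc] using h
    · rw [if_neg hκ, mul_div_assoc', mul_sub, ← Real.exp_add, mul_one]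
      ring_nf

lemma exists_truncTransport_le {η ν : ℕ → ℝ} (hη0 : ∀ x, 0 ≤ η x) (hν0 : ∀ x, 0 ≤ ν x)
    (hν : ν 0 = 0) {C : ℝ} (hC : 0 < C) (hη : ∀ x : ℕ, η x ≤ C * (1 + x))
    (hκ : BddBelow (Set.range fun x : ℕ => η x + ν (x + 1) - η (x + 1) - ν x))
    (hLipη : BddAbove (Set.range fun x : ℕ => |η (x + 1) - η x|))
    (hLipν : BddAbove (Set.range fun x : ℕ => |ν (x + 1) - ν x|))
    {ρ : ℝ} (hρ1 : 1 < ρ) (hρ2 : ρ ≤ 2) {p q : ℝ → ℕ → ℝ} (hp : IsBDMarginal η ν p)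
    (hq : IsBDMarginal η ν q) (hsp : Summable fun n : ℕ => p 0 n * ((n : ℝ) + 1) ^ ρ)
    (hsq : Summable fun n : ℕ => q 0 n * ((n : ℝ) + 1) ^ ρ) {J : ℝ → ℝ} (hJ0 : J 0 = 0)
    (hJ : ∀ t, HasDerivAt J (Real.exp (bdKappa η ν * (ρ - 1) * t)) t) {T : ℝ} (hT : 0 ≤ T) :
    ∃ δ : ℕ → ℝ, Filter.Tendsto δ Filter.atTop (nhds 0) ∧ ∀ M,
      truncTransport ρ M (p T) (q T) ≤ Real.exp (-(bdKappa η ν * ρ) * T) *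
        (wassersteinPow ρ (pmfMeasure (p 0)) (pmfMeasure (q 0)) + (bdLip η + bdLip ν) *
          (wassersteinPow 1 (pmfMeasure (p 0)) (pmfMeasure (q 0))
            + δ M * Real.exp (|bdKappa η ν * 1| * T) * T) * J T
          + δ M * Real.exp (|bdKappa η ν * ρ| * T) * T) := by
  obtain ⟨hp0, hp1⟩ := hp.1 0 le_rfl
  obtain ⟨hq0, hq1⟩ := hq.1 0 le_rfl
  set κ := bdKappa η ν
  set L := bdLip η + bdLip ν
  have hL0 : 0 ≤ L := add_nonneg (bdLip_nonneg _) (bdLip_nonneg _)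
  set K := C + bdLip ν
  have hK0 : 0 ≤ K := add_nonneg hC.le (bdLip_nonneg _)
  have hK : ∀ x : ℕ, η x ≤ K * (1 + x) := fun x =>
    (hη x).trans (by gcongr; linarith [bdLip_nonneg ν])
  have hK' : ∀ x : ℕ, ν x ≤ K * (1 + x) := fun x => by
    have h := (le_abs_self _).trans (abs_sub_le_bdLip hLipν 0 x)
    rw [zero_add, hν, sub_zero] at h
    have hx : (0 : ℝ) ≤ x := x.cast_nonneg
    nlinarith [bdLip_nonneg ν]
  set A := 6 * K + 2 * |κ|
  have hA0 : 0 ≤ A := by positivity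
  set E : ℕ → ℝ := fun M => ∑' n, p 0 n * tailFun ρ M n + ∑' n, q 0 n * tailFun ρ M n with hE
  have hE0 : ∀ M, 0 ≤ E M := fun M => add_nonneg
    (tsum_nonneg fun n => mul_nonneg (hp0 n) (tailFun_nonneg ρ M n))
    (tsum_nonneg fun n => mul_nonneg (hq0 n) (tailFun_nonneg ρ M n))
  have hElim : Filter.Tendsto E Filter.atTop (nhds 0) := by
    simpa using (tendsto_tsum_mul_tailFun hp0 hsp).add (tendsto_tsum_mul_tailFun hq0 hsq)
  refine ⟨fun M => A * Real.exp (C * 7 * T) * E M, by simpa using hElim.const_mul _,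
    fun M => ?_⟩
  set δ := A * Real.exp (C * 7 * T) * E M with hδ
  have hδ0 : 0 ≤ δ := mul_nonneg (by positivity) (hE0 M)
  have hderiv : ∀ r θ : ℝ, 1 ≤ r → r ≤ ρ → 0 ≤ θ → StepBound r θ → ∀ t ∈ Set.Ico 0 T, ∃ d,
      HasDerivWithinAt (fun s => truncTransport r M (p s) (q s)) d (Set.Ici t) t ∧
      d ≤ -(κ * r) * truncTransport r M (p t) (q t)
        + θ * L * truncTransport 1 M (p t) (q t) + δ := by
    intro r θ hr hrρ hθ hstep t ht
    have hmom := fun (u : ℝ → ℕ → ℝ) (hu : IsBDMarginal η ν u)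
        (hs : Summable fun n : ℕ => u 0 n * ((n : ℝ) + 1) ^ ρ) =>
      hu.moment_bound hν0 hν hC.le hη (tailFun_nonneg ρ M) (tailFun_mono (by linarith) M)
        (succ_mul_tailFun_sub_le hρ2 M) (by norm_num)
        (summable_mul_tailFun (hu.1 0 le_rfl).1 hs M) ht.1
    obtain ⟨hspt, hpt⟩ := hmom p hp hsp
    obtain ⟨hsqt, hqt⟩ := hmom q hq hsq
    obtain ⟨d, hd, hle⟩ := exists_hasDerivWithinAt_truncTransport hη0 hν0 hν hp hq hr
      (tailFun_nonneg ρ M) (bdCouplingGen_truncCost_le hη0 hν0 hν hκ hLipη hLipν hK hK' hr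
        (hrρ.trans hρ2) hrρ hθ hstep M) ht.1 hspt hsqt
    refine ⟨d, hd, hle.trans (add_le_add le_rfl ?_)⟩
    calc A * (∑' n, p t n * tailFun ρ M n + ∑' n, q t n * tailFun ρ M n)
        ≤ A * (Real.exp (C * 7 * t) * E M) := by
          rw [hE, mul_add (Real.exp _)]
          gcongr
      _ ≤ A * (Real.exp (C * 7 * T) * E M) := by
          have := ht.2.le
          have := hE0 M
          gcongr
      _ = δ := by rw [hδ]; ring
  have hlin : ∀ c t : ℝ, HasDerivAt (fun t => c * t) c t := fun c t => by
    simpa using (hasDerivAt_id t).const_mul c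
  set W₁ := wassersteinPow 1 (pmfMeasure (p 0)) (pmfMeasure (q 0))
  have hone := le_exp_mul_of_exists_deriv_right_le (a := κ * 1)
    (B := fun t => W₁ + δ * Real.exp (|κ * 1| * T) * t)
    (continuousOn_truncTransport hν hp hq 1 M T) (fun t => (hlin _ t).const_add W₁)
    (by simpa using
      truncTransport_le_wassersteinPow hp0 hp1 hq0 hq1 le_rfl hρ1.le hsp hsq M)
    (fun t ht => by
      obtain ⟨d, hd, hle⟩ := hderiv 1 0 le_rfl hρ1.le le_rfl stepBound_one t ht
      refine ⟨d, hd, hle.trans ?_⟩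
      linarith [le_exp_neg_mul_mul_exp_abs_mul (a := κ * 1) hδ0 ht.1 ht.2.le])
  set D := W₁ + δ * Real.exp (|κ * 1| * T) * T with hD
  refine le_exp_mul_of_exists_deriv_right_le (a := κ * ρ)
    (B := fun t => wassersteinPow ρ (pmfMeasure (p 0)) (pmfMeasure (q 0)) + L * D * J t
      + δ * Real.exp (|κ * ρ| * T) * t)
    (continuousOn_truncTransport hν hp hq ρ M T)
    (fun t => (((hJ t).const_mul (L * D)).const_add _).add (hlin _ t))
    (by simpa [hJ0] using
      truncTransport_le_wassersteinPow hp0 hp1 hq0 hq1 hρ1.le le_rfl hsp hsq M)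
    (fun t ht => ?_) T ⟨hT, le_rfl⟩
  obtain ⟨d, hd, hle⟩ := hderiv ρ 1 hρ1.le le_rfl zero_le_one (stepBound_of_mem hρ1 hρ2) t ht
  refine ⟨d, hd, hle.trans ?_⟩
  have hΨ : truncTransport 1 M (p t) (q t) ≤ Real.exp (-(κ * 1) * t) * D := by
    refine (hone t ⟨ht.1, ht.2.le⟩).trans ?_
    rw [hD]
    have := ht.2.le
    gcongr
  have hexp : Real.exp (-(κ * ρ) * t) * Real.exp (κ * (ρ - 1) * t) = Real.exp (-(κ * 1) * t) := by
    rw [← Real.exp_add]; ring_nf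
  have h1 := mul_le_mul_of_nonneg_left hΨ hL0
  rw [← hexp] at h1
  linarith [le_exp_neg_mul_mul_exp_abs_mul (a := κ * ρ) hδ0 ht.1 ht.2.le]

/-- for `ρ ∈ (1,2]`, birth and death processes with affine-growth birth rate,
finite curvature `κ` and Lipschitz rates satisfy
`W_ρ^ρ(P_t,P̃_t) ≤ W_ρ^ρ(P₀,P̃₀)e^{−κρt} + (Lip(η)+Lip(ν)) W₁(P₀,P̃₀) (e^{−κt}−e^{−κρt})/(κ(ρ−1))`,
where for `κ = 0` the fraction `(e^{−κt}−e^{−κρt})/κ` is interpreted as its limit `t(ρ−1)`. -/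
theorem stmt10 (η ν : ℕ → ℝ) (hη0 : ∀ x, 0 ≤ η x) (hν0 : ∀ x, 0 ≤ ν x) (hν : ν 0 = 0)
    (C : ℝ) (hC : 0 < C) (hηgrowth : ∀ x : ℕ, η x ≤ C * (1 + x))
    (hκ : BddBelow (Set.range fun x : ℕ => η x + ν (x + 1) - η (x + 1) - ν x))
    (hLipη : BddAbove (Set.range fun x : ℕ => |η (x + 1) - η x|))
    (hLipν : BddAbove (Set.range fun x : ℕ => |ν (x + 1) - ν x|))
    (ρ : ℝ) (hρ1 : 1 < ρ) (hρ2 : ρ ≤ 2)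
    (p pt : ℝ → ℕ → ℝ) (hp : IsBDMarginal η ν p) (hpt : IsBDMarginal η ν pt)
    (hm : Summable fun n : ℕ => (n : ℝ) ^ ρ * p 0 n)
    (hmt : Summable fun n : ℕ => (n : ℝ) ^ ρ * pt 0 n) :
    ∀ t : ℝ, 0 ≤ t →
      wassersteinPow ρ (pmfMeasure (p t)) (pmfMeasure (pt t))
        ≤ wassersteinPow ρ (pmfMeasure (p 0)) (pmfMeasure (pt 0))
            * Real.exp (-(bdKappa η ν) * ρ * t)
          + (bdLip η + bdLip ν) * wassersteinPow 1 (pmfMeasure (p 0)) (pmfMeasure (pt 0)) *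
              (if bdKappa η ν = 0 then t
               else (Real.exp (-(bdKappa η ν) * t) - Real.exp (-(bdKappa η ν) * ρ * t))
                  / (bdKappa η ν * (ρ - 1))) := by
  intro t ht
  obtain ⟨J, hJ0, hJ, hJt⟩ := exists_hasDerivAt_exp (bdKappa η ν) hρ1
  have hmom : ∀ u : ℝ → ℕ → ℝ, IsBDMarginal η ν u → (Summable fun n : ℕ => (n : ℝ) ^ ρ * u 0 n) →
      (Summable fun n : ℕ => u 0 n * ((n : ℝ) + 1) ^ ρ) ∧
        Summable fun n : ℕ => u t n * ((n : ℝ) + 1) ^ ρ := fun u hu hmu => by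
    have hs := summable_mul_succ_rpow (hu.1 0 le_rfl).1 (hu.1 0 le_rfl).2 (by linarith) hmu
    refine ⟨hs, ?_⟩
    have := (hu.moment_bound hν0 hν hC.le hηgrowth (tailFun_nonneg ρ 0)
      (tailFun_mono (by linarith) 0) (succ_mul_tailFun_sub_le hρ2 0) (by norm_num)
      (summable_mul_tailFun (hu.1 0 le_rfl).1 hs 0) ht).1
    simpa only [tailFun_eq (Nat.zero_le _)] using this
  obtain ⟨hp0, hpT⟩ := hmom p hp hm
  obtain ⟨hq0, hqT⟩ := hmom pt hpt hmt
  obtain ⟨δ, hδ, hle⟩ := exists_truncTransport_le hη0 hν0 hν hC hηgrowth hκ hLipη hLipν hρ1 hρ2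
    hp hpt hp0 hq0 hJ0 hJ ht
  refine wassersteinPow_le_of_truncTransport_le (hp.1 t ht).1 (hp.1 t ht).2 (hpt.1 t ht).1
    (hpt.1 t ht).2 hρ1.le hpT hqT ?_ hle
  have hlim := (((((((hδ.mul_const (Real.exp (|bdKappa η ν * 1| * t))).mul_const t).const_add
    (wassersteinPow 1 (pmfMeasure (p 0)) (pmfMeasure (pt 0)))).const_mul
    (bdLip η + bdLip ν)).mul_const (J t)).const_add
    (wassersteinPow ρ (pmfMeasure (p 0)) (pmfMeasure (pt 0)))).add
    ((hδ.mul_const (Real.exp (|bdKappa η ν * ρ| * t))).mul_const t)).const_mul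
    (Real.exp (-(bdKappa η ν * ρ) * t))
  convert hlim using 2
  rw [← hJt]
  ring_nf
end

section
/- Consider a birth and death process with birth rate η satisfying η(x) ≤ C(1+x) for all x∈ℕ (for some C>0) and death rate ν with ν(0)=0, with time marginals {P_t} and initial law P₀. Let ρ≥1 and set c_ρ = sup_{x∈ℕ} (1+x)((1+x)^ρ−x^ρ)/(1+x^ρ), which is finite. Then for every t≥0, ∫ x^ρ P_t(dx) ≤ (∫ x^ρ P₀(dx) + 1) e^{c_ρ C t} − 1. -/
open MeasureTheory
open scoped ENNReal

/-- The constant `c_ρ = sup_{x ∈ ℕ} (1+x)((1+x)^ρ − x^ρ)/(1+x^ρ)`. -/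
noncomputable def bdCrho (ρ : ℝ) : ℝ :=
  ⨆ x : ℕ, ((1 + (x : ℝ)) * ((1 + (x : ℝ)) ^ ρ - (x : ℝ) ^ ρ)) / (1 + (x : ℝ) ^ ρ)

theorem bdCrho_bddAbove (ρ : ℝ) (hρ : 1 ≤ ρ) :
    BddAbove (Set.range fun x : ℕ =>
      ((1 + (x : ℝ)) * ((1 + (x : ℝ)) ^ ρ - (x : ℝ) ^ ρ)) / (1 + (x : ℝ) ^ ρ)) := by
  refine ⟨ρ * 2 ^ (ρ - 1), ?_⟩
  rintro _ ⟨x, rfl⟩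
  have hx : (0 : ℝ) ≤ x := x.cast_nonneg
  have hx1 : (0 : ℝ) < 1 + x := by positivity
  have hxρ : 0 ≤ (x : ℝ) ^ ρ := Real.rpow_nonneg hx ρ
  have bernoulli : 1 + ρ * (-1 / (1 + x)) ≤ (1 + -1 / (1 + (x : ℝ))) ^ ρ := by
    apply one_add_mul_self_le_rpow_one_add _ hρ
    rw [le_div_iff₀ hx1]
    linarith
  have hquot : 1 + -1 / (1 + (x : ℝ)) = x / (1 + x) := by field_simp; ring
  rw [hquot, Real.div_rpow hx hx1.le, le_div_iff₀ (by positivity)] at bernoulli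
  have hdiff : (1 + (x : ℝ)) * ((1 + (x : ℝ)) ^ ρ - (x : ℝ) ^ ρ) ≤ ρ * (1 + x) ^ ρ := by
    have hcancel : (1 + ρ * (-1 / (1 + (x : ℝ)))) * (1 + x) = 1 + x - ρ := by field_simp; ring
    have := mul_le_mul_of_nonneg_left bernoulli hx1.le
    have hexpand : (1 + (x : ℝ)) * ((1 + ρ * (-1 / (1 + x))) * (1 + (x : ℝ)) ^ ρ)
        = (1 + x - ρ) * (1 + (x : ℝ)) ^ ρ := by rw [← hcancel]; ring
    linarith
  have hconv : (1 + (x : ℝ)) ^ ρ ≤ 2 ^ (ρ - 1) * (1 + (x : ℝ) ^ ρ) := by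
    have h := NNReal.rpow_add_le_mul_rpow_add_rpow 1 x hρ
    rw [NNReal.one_rpow] at h
    exact_mod_cast h
  rw [div_le_iff₀ (by positivity)]
  nlinarith

theorem mul_rpow_sub_le_bdCrho (ρ : ℝ) (hρ : 1 ≤ ρ) (x : ℕ) :
    (1 + (x : ℝ)) * ((1 + (x : ℝ)) ^ ρ - (x : ℝ) ^ ρ) ≤ bdCrho ρ * (1 + (x : ℝ) ^ ρ) := by
  have hxρ : 0 ≤ (x : ℝ) ^ ρ := Real.rpow_nonneg x.cast_nonneg ρ
  rw [← div_le_iff₀ (by positivity)]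
  exact le_ciSup (bdCrho_bddAbove ρ hρ) x

theorem bdCrho_nonneg (ρ : ℝ) (hρ : 1 ≤ ρ) : 0 ≤ bdCrho ρ := by
  have h := mul_rpow_sub_le_bdCrho ρ hρ 0
  have hρ0 : ρ ≠ 0 := by positivity
  simp only [Nat.cast_zero, add_zero, Real.one_rpow, Real.zero_rpow hρ0] at h
  linarith

/-- Summation by parts: the forward operator applied to `q`, paired with `g` on `{0, …, N}`. -/
theorem sum_mul_forward (η ν : ℕ → ℝ) (hν : ν 0 = 0) (g q : ℕ → ℝ) (N : ℕ) :
    ∑ x ∈ Finset.range (N + 1), g x * ((if x = 0 then 0 else η (x - 1) * q (x - 1))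
        + ν (x + 1) * q (x + 1) - (η x + ν x) * q x)
      = ∑ x ∈ Finset.range (N + 1),
          (η x * (g (x + 1) - g x) + ν x * (g (x - 1) - g x)) * q x
        + ν (N + 1) * g N * q (N + 1) - η N * g (N + 1) * q N := by
  induction N with
  | zero => simp [hν]; ring
  | succ N ih =>
    rw [Finset.sum_range_succ, ih, Finset.sum_range_succ _ (N + 1)]
    simp only [Nat.add_eq_zero_iff, one_ne_zero, and_false, if_false, Nat.add_sub_cancel]
    ring

/-- The pairing of the law at time `t` with the compactly supported function
`x ↦ ((N + 1) ^ ρ - x ^ ρ)⁺`. -/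
noncomputable def truncatedDefect (p : ℝ → ℕ → ℝ) (ρ : ℝ) (N : ℕ) (t : ℝ) : ℝ :=
  ∑ x ∈ Finset.range (N + 1), (((N + 1 : ℕ) : ℝ) ^ ρ - (x : ℝ) ^ ρ) * p t x

theorem hasSum_min_rpow_mul {p : ℝ → ℕ → ℝ} {t : ℝ} (hsum : HasSum (p t) 1)
    {ρ : ℝ} (hρ : 0 ≤ ρ) (N : ℕ) :
    HasSum (fun n : ℕ => min ((n : ℝ) ^ ρ) (((N + 1 : ℕ) : ℝ) ^ ρ) * p t n)
      (((N + 1 : ℕ) : ℝ) ^ ρ - truncatedDefect p ρ N t) := by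
  set K : ℝ := ((N + 1 : ℕ) : ℝ) ^ ρ
  have hlt : ∀ n ∈ Finset.range (N + 1), (n : ℝ) ^ ρ ≤ K := fun n hn =>
    Real.rpow_le_rpow n.cast_nonneg (Nat.cast_le.2 (Finset.mem_range.1 hn).le) hρ
  have hdefect : HasSum (fun n : ℕ => (K - min ((n : ℝ) ^ ρ) K) * p t n)
      (truncatedDefect p ρ N t) := by
    have hfin : truncatedDefect p ρ N t
        = ∑ n ∈ Finset.range (N + 1), (K - min ((n : ℝ) ^ ρ) K) * p t n :=
      Finset.sum_congr rfl fun n hn => by rw [min_eq_left (hlt n hn)]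
    rw [hfin]
    refine hasSum_sum_of_ne_finset_zero fun n hn => ?_
    have hle : K ≤ (n : ℝ) ^ ρ :=
      Real.rpow_le_rpow (Nat.cast_nonneg _)
        (Nat.cast_le.2 (not_lt.1 fun h => hn (Finset.mem_range.2 h))) hρ
    rw [min_eq_right hle, sub_self, zero_mul]
  have h := (hsum.mul_left K).sub hdefect
  rw [mul_one] at h
  refine (congrArg (HasSum · _) (funext fun n => ?_)).mp h
  ring

theorem hasDerivWithinAt_truncatedDefect {η ν : ℕ → ℝ} {p : ℝ → ℕ → ℝ}
    (hp : IsBDMarginal η ν p) (hν : ν 0 = 0) (ρ : ℝ) (N : ℕ) {t : ℝ} (ht : 0 ≤ t) :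
    HasDerivWithinAt (truncatedDefect p ρ N)
      (∑ x ∈ Finset.range (N + 1),
          (η x * ((x : ℝ) ^ ρ - ((x + 1 : ℕ) : ℝ) ^ ρ)
            + ν x * ((x : ℝ) ^ ρ - ((x - 1 : ℕ) : ℝ) ^ ρ)) * p t x
        + ν (N + 1) * (((N + 1 : ℕ) : ℝ) ^ ρ - (N : ℝ) ^ ρ) * p t (N + 1)) (Set.Ici 0) t := by
  have h := HasDerivWithinAt.fun_sum (u := Finset.range (N + 1)) fun x _ =>
    (hp.2 x t ht).const_mul (((N + 1 : ℕ) : ℝ) ^ ρ - (x : ℝ) ^ ρ)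
  rw [sum_mul_forward η ν hν (fun x => ((N + 1 : ℕ) : ℝ) ^ ρ - (x : ℝ) ^ ρ) (p t) N] at h
  simp only [sub_self, mul_zero, zero_mul, sub_zero, sub_sub_sub_cancel_left] at h
  exact h

/-- The truncated moment, increased by one, grows at most exponentially. -/
theorem one_add_rpow_sub_truncatedDefect_le {η ν : ℕ → ℝ} (hν0 : ∀ x, 0 ≤ ν x) (hν : ν 0 = 0)
    {C : ℝ} (hC : 0 < C) (hηgrowth : ∀ x : ℕ, η x ≤ C * (1 + x))
    {p : ℝ → ℕ → ℝ} (hp : IsBDMarginal η ν p) {ρ : ℝ} (hρ : 1 ≤ ρ) (N : ℕ)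
    {t : ℝ} (ht : 0 ≤ t) :
    1 + ((N + 1 : ℕ) : ℝ) ^ ρ - truncatedDefect p ρ N t
      ≤ (1 + ((N + 1 : ℕ) : ℝ) ^ ρ - truncatedDefect p ρ N 0)
        * Real.exp (bdCrho ρ * C * t) := by
  have hρ0 : 0 ≤ ρ := by linarith
  set c := bdCrho ρ * C
  have hc0 : 0 ≤ c := mul_nonneg (bdCrho_nonneg ρ hρ) hC.le
  set K : ℝ := ((N + 1 : ℕ) : ℝ) ^ ρ
  have hK0 : 0 ≤ K := Real.rpow_nonneg (Nat.cast_nonneg _) ρ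
  have hderiv : ∀ s, 0 ≤ s → ∃ d, HasDerivWithinAt (truncatedDefect p ρ N) d (Set.Ici 0) s ∧
      -(c * (1 + K - truncatedDefect p ρ N s)) ≤ d := by
    intro s hs
    refine ⟨_, hasDerivWithinAt_truncatedDefect hp hν ρ N hs, ?_⟩
    obtain ⟨hpos, hsum⟩ := hp.1 s hs
    have hboundary : 0 ≤ ν (N + 1) * (K - (N : ℝ) ^ ρ) * p s (N + 1) := by
      refine mul_nonneg (mul_nonneg (hν0 _) (sub_nonneg.2 ?_)) (hpos _)
      exact Real.rpow_le_rpow (Nat.cast_nonneg _) (Nat.cast_le.2 N.le_succ) hρ0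
    have hterm : ∀ x ∈ Finset.range (N + 1), -(c * (1 + (x : ℝ) ^ ρ)) * p s x ≤
        (η x * ((x : ℝ) ^ ρ - ((x + 1 : ℕ) : ℝ) ^ ρ)
            + ν x * ((x : ℝ) ^ ρ - ((x - 1 : ℕ) : ℝ) ^ ρ)) * p s x := by
      intro x _
      refine mul_le_mul_of_nonneg_right ?_ (hpos x)
      have hdeath : 0 ≤ ν x * ((x : ℝ) ^ ρ - ((x - 1 : ℕ) : ℝ) ^ ρ) :=
        mul_nonneg (hν0 x) (sub_nonneg.2
          (Real.rpow_le_rpow (Nat.cast_nonneg _) (Nat.cast_le.2 (Nat.sub_le x 1)) hρ0))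
      have hmono : 0 ≤ ((x + 1 : ℕ) : ℝ) ^ ρ - (x : ℝ) ^ ρ := sub_nonneg.2
        (Real.rpow_le_rpow (Nat.cast_nonneg _) (Nat.cast_le.2 x.le_succ) hρ0)
      have hbirth := mul_le_mul_of_nonneg_right (hηgrowth x) hmono
      have hcρ := mul_le_mul_of_nonneg_left (mul_rpow_sub_le_bdCrho ρ hρ x) hC.le
      have hcast : ((x + 1 : ℕ) : ℝ) = 1 + x := by push_cast; ring
      rw [hcast] at hbirth ⊢
      linear_combination hbirth + hcρ + hdeath
    have hmass : ∑ x ∈ Finset.range (N + 1), p s x ≤ 1 :=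
      sum_le_hasSum _ (fun x _ => hpos x) hsum
    have hrewrite : ∑ x ∈ Finset.range (N + 1), -(c * (1 + (x : ℝ) ^ ρ)) * p s x
        = -(c * ((1 + K) * ∑ x ∈ Finset.range (N + 1), p s x - truncatedDefect p ρ N s)) := by
      rw [truncatedDefect, Finset.mul_sum, ← Finset.sum_sub_distrib, Finset.mul_sum,
        ← Finset.sum_neg_distrib]
      exact Finset.sum_congr rfl fun x _ => by ring
    have hlower := Finset.sum_le_sum hterm
    have := mul_le_mul_of_nonneg_left (mul_le_mul_of_nonneg_left hmass
      (by positivity : 0 ≤ 1 + K)) hc0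
    linarith
  choose! d hd hdle using hderiv
  have hexp : ∀ s, HasDerivAt (fun s => Real.exp (-(c * s))) (Real.exp (-(c * s)) * -(c * 1)) s :=
    fun s => (((hasDerivAt_id s).const_mul c).neg).exp
  have hprod : ∀ s, 0 ≤ s → HasDerivWithinAt
      (fun s => (1 + K - truncatedDefect p ρ N s) * Real.exp (-(c * s)))
      (-d s * Real.exp (-(c * s))
        + (1 + K - truncatedDefect p ρ N s) * (Real.exp (-(c * s)) * -(c * 1))) (Set.Ici 0) s :=
    fun s hs => ((hd s hs).const_sub (1 + K)).mul (hexp s).hasDerivWithinAt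
  have hanti : AntitoneOn (fun s => (1 + K - truncatedDefect p ρ N s) * Real.exp (-(c * s)))
      (Set.Ici 0) := by
    refine antitoneOn_of_hasDerivWithinAt_nonpos (convex_Ici 0)
      (fun s hs => (hprod s hs).continuousWithinAt)
      (fun s hs => (hprod s (interior_subset hs)).mono interior_subset) fun s hs => ?_
    have := mul_le_mul_of_nonneg_right (hdle s (interior_subset hs)) (Real.exp_pos (-(c * s))).le
    linarith
  have h := hanti (Set.mem_Ici.2 le_rfl) (Set.mem_Ici.2 ht) ht
  simp only [mul_zero, neg_zero, Real.exp_zero, mul_one, Real.exp_neg] at h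
  rwa [← div_eq_mul_inv, div_le_iff₀ (Real.exp_pos _)] at h

theorem ofReal_rpow_sub_truncatedDefect {p : ℝ → ℕ → ℝ} {t : ℝ} (hpos : ∀ x, 0 ≤ p t x)
    (hsum : HasSum (p t) 1) {ρ : ℝ} (hρ : 0 ≤ ρ) (N : ℕ) :
    ENNReal.ofReal (((N + 1 : ℕ) : ℝ) ^ ρ - truncatedDefect p ρ N t)
      = ∑' n : ℕ, ENNReal.ofReal (min ((n : ℝ) ^ ρ) (((N + 1 : ℕ) : ℝ) ^ ρ) * p t n) := by
  have h := hasSum_min_rpow_mul hsum hρ N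
  rw [← h.tsum_eq]
  exact ENNReal.ofReal_tsum_of_nonneg (fun n => mul_nonneg (le_min
    (Real.rpow_nonneg (Nat.cast_nonneg _) ρ) (Real.rpow_nonneg (Nat.cast_nonneg _) ρ))
    (hpos n)) h.summable

/-- moment estimate for a birth and death process with affine-growth birth
rate: `c_ρ` is finite and `∫ x^ρ P_t(dx) ≤ (∫ x^ρ P₀(dx) + 1) e^{c_ρ C t} − 1`. -/
theorem stmt11 (η ν : ℕ → ℝ) (hη0 : ∀ x, 0 ≤ η x) (hν0 : ∀ x, 0 ≤ ν x) (hν : ν 0 = 0)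
    (C : ℝ) (hC : 0 < C) (hηgrowth : ∀ x : ℕ, η x ≤ C * (1 + x))
    (p : ℝ → ℕ → ℝ) (hp : IsBDMarginal η ν p)
    (ρ : ℝ) (hρ : 1 ≤ ρ) :
    BddAbove (Set.range fun x : ℕ =>
      ((1 + (x : ℝ)) * ((1 + (x : ℝ)) ^ ρ - (x : ℝ) ^ ρ)) / (1 + (x : ℝ) ^ ρ)) ∧
    ∀ t : ℝ, 0 ≤ t →
      ∑' n : ℕ, ENNReal.ofReal ((n : ℝ) ^ ρ * p t n)
        ≤ ((∑' n : ℕ, ENNReal.ofReal ((n : ℝ) ^ ρ * p 0 n)) + 1)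
            * ENNReal.ofReal (Real.exp (bdCrho ρ * C * t)) - 1 := by
  refine ⟨bdCrho_bddAbove ρ hρ, fun t ht => ?_⟩
  have hρ0 : 0 ≤ ρ := by linarith
  obtain ⟨hpos, hsum⟩ := hp.1 t ht
  obtain ⟨hpos0, hsum0⟩ := hp.1 0 le_rfl
  rw [ENNReal.tsum_eq_iSup_nat]
  refine iSup_le fun N => ENNReal.le_sub_of_add_le_right ENNReal.one_ne_top ?_
  set K : ℝ := ((N + 1 : ℕ) : ℝ) ^ ρ
  have hpartial : ∑ n ∈ Finset.range N, ENNReal.ofReal ((n : ℝ) ^ ρ * p t n)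
      ≤ ENNReal.ofReal (K - truncatedDefect p ρ N t) := by
    rw [ofReal_rpow_sub_truncatedDefect hpos hsum hρ0]
    refine le_trans (Finset.sum_le_sum fun n hn => ?_) (ENNReal.sum_le_tsum (Finset.range N))
    rw [min_eq_left]
    exact Real.rpow_le_rpow (Nat.cast_nonneg _)
      (Nat.cast_le.2 ((Finset.mem_range.1 hn).le.trans N.le_succ)) hρ0
  have hinitial : ENNReal.ofReal (K - truncatedDefect p ρ N 0)
      ≤ ∑' n : ℕ, ENNReal.ofReal ((n : ℝ) ^ ρ * p 0 n) := by
    rw [ofReal_rpow_sub_truncatedDefect hpos0 hsum0 hρ0]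
    exact ENNReal.tsum_le_tsum fun n => ENNReal.ofReal_le_ofReal
      (mul_le_mul_of_nonneg_right (min_le_left _ _) (hpos0 n))
  have hnonneg : ∀ s, 0 ≤ s → 0 ≤ K - truncatedDefect p ρ N s := fun s hs =>
    (hasSum_min_rpow_mul (hp.1 s hs).2 hρ0 N).nonneg fun n => mul_nonneg (le_min
      (Real.rpow_nonneg (Nat.cast_nonneg _) ρ) (Real.rpow_nonneg (Nat.cast_nonneg _) ρ))
      ((hp.1 s hs).1 n)
  have hgrowth := one_add_rpow_sub_truncatedDefect_le hν0 hν hC hηgrowth hp hρ N ht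
  calc _ ≤ ENNReal.ofReal (K - truncatedDefect p ρ N t) + 1 := by gcongr
    _ = ENNReal.ofReal (1 + K - truncatedDefect p ρ N t) := by
      rw [← ENNReal.ofReal_one, ← ENNReal.ofReal_add (hnonneg t ht) one_pos.le]
      congr 1
      ring
    _ ≤ ENNReal.ofReal ((1 + K - truncatedDefect p ρ N 0) * Real.exp (bdCrho ρ * C * t)) :=
      ENNReal.ofReal_le_ofReal hgrowth
    _ = (ENNReal.ofReal (K - truncatedDefect p ρ N 0) + 1)
          * ENNReal.ofReal (Real.exp (bdCrho ρ * C * t)) := by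
      rw [ENNReal.ofReal_mul (by linarith [hnonneg 0 le_rfl]), ← ENNReal.ofReal_one,
        ← ENNReal.ofReal_add (hnonneg 0 le_rfl) one_pos.le]
      congr 2
      ring
    _ ≤ _ := by gcongr
end

section
/- Consider a pure jump Markov process on ℝ^d with data (λ,k,P₀) and time marginals {P_t}, where λ̄:=sup_x λ(x)<∞. Then for every t>0, s≥0, every measurable f:ℝ^d→ℝ̄ and every η>0, ∫|f(x)| P_s(dx) ≤ 1_{{s≤t}} e^{λ̄(t−s)} ∫|f(x)| P_t(dx) + 1_{{s>t}} e^{ηλ̄s(s/t)^{1/η}/(1+η)} ( ∫|f(x)|^{1+η} P_t(dx) )^{1/(1+η)}. -/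
open MeasureTheory ProbabilityTheory
open scoped ENNReal

/-- The measure `P_{n,t}` of the pure jump Markov process, defined recursively over the
last jump time. -/
noncomputable def jumpMarginalN {E : Type*} [MeasurableSpace E]
    (l : E → ℝ) (k : Kernel E E) (P0 : Measure E) : ℕ → ℝ → Measure E
  | 0, t => P0.withDensity fun x => ENNReal.ofReal (Real.exp (-(l x) * t))
  | n + 1, t =>
      (volume.restrict (Set.Icc (0:ℝ) t)).bind fun s =>
        ((jumpMarginalN l k P0 n s).withDensity fun x => ENNReal.ofReal (l x)).bind
          fun x => (k x).withDensity fun y => ENNReal.ofReal (Real.exp (-(l y) * (t - s)))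

/-- The time-`t` marginal `P_t = Σ_n P_{n,t}`. -/
noncomputable def jumpMarginal {E : Type*} [MeasurableSpace E]
    (l : E → ℝ) (k : Kernel E E) (P0 : Measure E) (t : ℝ) : Measure E :=
  Measure.sum fun n => jumpMarginalN l k P0 n t


section
variable {E : Type*} [MeasurableSpace E] {l : E → ℝ} {k : Kernel E E} {P0 : Measure E}

theorem measurable_withDensity_exp [IsMarkovKernel k] (hl : Measurable l) (τ : ℝ) :
    Measurable fun x => (k x).withDensity fun y => ENNReal.ofReal (Real.exp (-(l y) * τ)) := by
  refine Measure.measurable_of_measurable_coe _ fun A hA => ?_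
  simp only [withDensity_apply _ hA, ← lintegral_indicator hA]
  exact Measurable.lintegral_kernel (Measurable.indicator (by fun_prop) hA)

theorem lintegral_jump_step [IsMarkovKernel k] (hl : Measurable l) (μ : Measure E) (τ : ℝ)
    {f : E → ℝ≥0∞} (hf : Measurable f) :
    ∫⁻ y, f y ∂((μ.withDensity fun x => ENNReal.ofReal (l x)).bind
        fun x => (k x).withDensity fun y => ENNReal.ofReal (Real.exp (-(l y) * τ))) =
      ∫⁻ x, ENNReal.ofReal (l x) *
        ∫⁻ y, ENNReal.ofReal (Real.exp (-(l y) * τ)) * f y ∂(k x) ∂μ := by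
  have hE : Measurable fun y => ENNReal.ofReal (Real.exp (-(l y) * τ)) := by fun_prop
  have hin : Measurable fun x => ∫⁻ y, ENNReal.ofReal (Real.exp (-(l y) * τ)) * f y ∂(k x) :=
    Measurable.lintegral_kernel (hE.mul hf)
  rw [Measure.lintegral_bind (measurable_withDensity_exp hl τ).aemeasurable hf.aemeasurable]
  simp only [lintegral_withDensity_eq_lintegral_mul _ hE hf, Pi.mul_apply]
  rw [lintegral_withDensity_eq_lintegral_mul _ (by fun_prop) hin]
  rfl

theorem lintegral_jumpMarginalN_zero (hl : Measurable l) (t : ℝ) {f : E → ℝ≥0∞}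
    (hf : Measurable f) :
    ∫⁻ x, f x ∂(jumpMarginalN l k P0 0 t) =
      ∫⁻ x, ENNReal.ofReal (Real.exp (-(l x) * t)) * f x ∂P0 := by
  rw [jumpMarginalN, lintegral_withDensity_eq_lintegral_mul _ (by fun_prop) hf]
  rfl

theorem measurable_jump_integrand [IsMarkovKernel k] (hl : Measurable l) {β : Type*}
    [MeasurableSpace β] {g : β × E → ℝ≥0∞} (hg : Measurable g) {τ : β → ℝ} (hτ : Measurable τ) :
    Measurable fun p : β × E => ENNReal.ofReal (l p.2) *
      ∫⁻ y, ENNReal.ofReal (Real.exp (-(l y) * τ p.1)) * g (p.1, y) ∂(k p.2) := by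
  refine Measurable.mul (by fun_prop) ?_
  exact Measurable.lintegral_kernel_prod_right' (κ := Kernel.prodMkLeft β k)
    (f := fun q : (β × E) × E =>
      ENNReal.ofReal (Real.exp (-(l q.2) * τ q.1.1)) * g (q.1.1, q.2)) (by fun_prop)

theorem lintegral_jumpMarginalN_succ_of_measurable [IsMarkovKernel k] (hl : Measurable l) {n : ℕ}
    (hn : ∀ g : ℝ × E → ℝ≥0∞, Measurable g →
      Measurable fun w => ∫⁻ x, g (w, x) ∂(jumpMarginalN l k P0 n w))
    (t : ℝ) {f : E → ℝ≥0∞} (hf : Measurable f) :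
    ∫⁻ x, f x ∂(jumpMarginalN l k P0 (n + 1) t) =
      ∫⁻ w in Set.Icc 0 t, ∫⁻ x, ENNReal.ofReal (l x) *
        ∫⁻ y, ENNReal.ofReal (Real.exp (-(l y) * (t - w))) * f y ∂(k x)
          ∂(jumpMarginalN l k P0 n w) := by
  have hm : Measurable fun w => ((jumpMarginalN l k P0 n w).withDensity
      fun x => ENNReal.ofReal (l x)).bind
        fun x => (k x).withDensity fun y => ENNReal.ofReal (Real.exp (-(l y) * (t - w))) := by
    refine Measure.measurable_of_measurable_coe _ fun A hA => ?_
    have hA1 : Measurable (A.indicator (1 : E → ℝ≥0∞)) := measurable_one.indicator hA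
    simp only [← lintegral_indicator_one hA, lintegral_jump_step hl _ _ hA1]
    exact hn _ (measurable_jump_integrand hl (hA1.comp measurable_snd)
      (measurable_const.sub measurable_id))
  rw [jumpMarginalN, Measure.lintegral_bind hm.aemeasurable hf.aemeasurable]
  simp only [lintegral_jump_step hl _ _ hf]

theorem measurable_lintegral_jumpMarginalN [IsMarkovKernel k] [SFinite P0] (hl : Measurable l)
    (n : ℕ) {β : Type} [MeasurableSpace β] {g : β × E → ℝ≥0∞} (hg : Measurable g)
    {h : β → ℝ} (hh : Measurable h) :
    Measurable fun b => ∫⁻ x, g (b, x) ∂(jumpMarginalN l k P0 n (h b)) := by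
  induction n generalizing β with
  | zero =>
    have hgb (b : β) : Measurable fun x => g (b, x) := by fun_prop
    simp only [lintegral_jumpMarginalN_zero hl _ (hgb _)]
    exact Measurable.lintegral_prod_right'
      (f := fun p : β × E => ENNReal.ofReal (Real.exp (-(l p.2) * h p.1)) * g p) (by fun_prop)
  | succ n ih =>
    have hgb (b : β) : Measurable fun x => g (b, x) := by fun_prop
    simp only [lintegral_jumpMarginalN_succ_of_measurable hl
      (fun g hg => ih hg measurable_id) _ (hgb _), ← lintegral_indicator measurableSet_Icc]
    have hin := ih (β := β × ℝ) (h := Prod.snd)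
      (measurable_jump_integrand (k := k) hl (g := fun q : (β × ℝ) × E => g (q.1.1, q.2))
        (by fun_prop) (τ := fun p : β × ℝ => h p.1 - p.2) (by fun_prop)) measurable_snd
    have hS : MeasurableSet {p : β × ℝ | p.2 ∈ Set.Icc 0 (h p.1)} :=
      (measurableSet_le measurable_const measurable_snd).inter
        (measurableSet_le measurable_snd (hh.comp measurable_fst))
    exact (hin.indicator hS).lintegral_prod_right'

theorem lintegral_jumpMarginalN_succ [IsMarkovKernel k] [SFinite P0] (hl : Measurable l) (n : ℕ)
    (t : ℝ) {f : E → ℝ≥0∞} (hf : Measurable f) :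
    ∫⁻ x, f x ∂(jumpMarginalN l k P0 (n + 1) t) =
      ∫⁻ w in Set.Icc 0 t, ∫⁻ x, ENNReal.ofReal (l x) *
        ∫⁻ y, ENNReal.ofReal (Real.exp (-(l y) * (t - w))) * f y ∂(k x)
          ∂(jumpMarginalN l k P0 n w) :=
  lintegral_jumpMarginalN_succ_of_measurable hl
    (fun _ hg => measurable_lintegral_jumpMarginalN hl n hg measurable_id) t hf

theorem ofReal_exp_neg_mul_le {a b s t : ℝ} (hab : a ≤ b) (hst : s ≤ t) :
    ENNReal.ofReal (Real.exp (-a * s)) ≤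
      ENNReal.ofReal (Real.exp (b * (t - s))) * ENNReal.ofReal (Real.exp (-a * t)) := by
  rw [← ENNReal.ofReal_mul (Real.exp_nonneg _), ← Real.exp_add]
  gcongr
  nlinarith

/-- For `s ≤ t`, the measure `P_{n,s}` is at most `e^{λ̄(t-s)} P_{n,t}`. -/
theorem lintegral_jumpMarginalN_le_of_le [IsMarkovKernel k] [SFinite P0] (hl : Measurable l)
    {lbar : ℝ} (hlbar : ∀ x, l x ≤ lbar) (n : ℕ) {s t : ℝ} (hst : s ≤ t)
    {f : E → ℝ≥0∞} (hf : Measurable f) :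
    ∫⁻ x, f x ∂(jumpMarginalN l k P0 n s) ≤
      ENNReal.ofReal (Real.exp (lbar * (t - s))) * ∫⁻ x, f x ∂(jumpMarginalN l k P0 n t) := by
  cases n with
  | zero =>
    rw [lintegral_jumpMarginalN_zero hl _ hf, lintegral_jumpMarginalN_zero hl _ hf,
      ← lintegral_const_mul' _ _ ENNReal.ofReal_ne_top]
    refine lintegral_mono fun x => ?_
    rw [← mul_assoc]
    gcongr
    exact ofReal_exp_neg_mul_le (hlbar x) hst
  | succ n =>
    rw [lintegral_jumpMarginalN_succ hl _ _ hf, lintegral_jumpMarginalN_succ hl _ _ hf,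
      ← lintegral_const_mul' _ _ ENNReal.ofReal_ne_top]
    refine (lintegral_mono_set (Set.Icc_subset_Icc_right hst)).trans (lintegral_mono fun w => ?_)
    rw [← lintegral_const_mul' _ _ ENNReal.ofReal_ne_top]
    refine lintegral_mono fun x => ?_
    rw [mul_left_comm,
      ← lintegral_const_mul' (ENNReal.ofReal (Real.exp (lbar * (t - s)))) _ ENNReal.ofReal_ne_top]
    gcongr ENNReal.ofReal (l x) * ?_
    refine lintegral_mono fun y => ?_
    rw [← mul_assoc]
    gcongr
    simpa using ofReal_exp_neg_mul_le (hlbar y) (sub_le_sub_right hst w)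

theorem lintegral_exp_mul_le {p q r τ : ℝ} (hpq : p.HolderConjugate q) (hr : 1 ≤ r) (hτ : 0 ≤ τ)
    (hl : Measurable l) (hl0 : ∀ x, 0 ≤ l x) (μ : Measure E) [IsProbabilityMeasure μ]
    {f : E → ℝ≥0∞} (hf : Measurable f) :
    ∫⁻ y, ENNReal.ofReal (Real.exp (-(l y) * (r * τ))) * f y ∂μ ≤
      (∫⁻ y, ENNReal.ofReal (Real.exp (-(l y) * τ)) * f y ^ p ∂μ) ^ (1 / p) := by
  have hp := hpq.pos
  have h := ENNReal.lintegral_mul_le_Lp_mul_Lq μ hpq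
    (f := fun y => ENNReal.ofReal (Real.exp (-(l y) * (r * τ))) * f y) (g := 1)
    (by fun_prop) (by fun_prop)
  simp only [mul_one, Pi.one_apply, ENNReal.one_rpow, lintegral_one, measure_univ] at h
  refine h.trans ?_
  gcongr with y
  rw [ENNReal.mul_rpow_of_nonneg _ _ hp.le, ENNReal.ofReal_rpow_of_nonneg (Real.exp_nonneg _) hp.le,
    ← Real.exp_mul]
  gcongr ENNReal.ofReal (Real.exp ?_) * _
  have := mul_nonneg (hl0 y) hτ
  nlinarith [one_le_mul_of_one_le_of_one_le hr hpq.lt.le]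

theorem setLIntegral_Icc_zero_mul {r : ℝ} (hr : 0 < r) (t : ℝ) (g : ℝ → ℝ≥0∞) :
    ∫⁻ w in Set.Icc 0 (r * t), g w = ∫⁻ w in Set.Icc 0 t, ENNReal.ofReal r * g (r * w) := by
  rw [lintegral_const_mul' _ _ ENNReal.ofReal_ne_top, ← lintegral_indicator measurableSet_Icc,
    ← lintegral_indicator measurableSet_Icc]
  conv_lhs => rw [← Real.smul_map_volume_mul_left hr.ne', abs_of_pos hr]
  rw [lintegral_smul_measure, smul_eq_mul,
    (measurableEmbedding_mulLeft₀ hr.ne').lintegral_map]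
  simp [Set.indicator, mul_nonneg_iff_of_pos_left hr, mul_le_mul_iff_right₀ hr]

theorem setLIntegral_Icc_pow_div_factorial {c t : ℝ} (hc : 0 ≤ c) (ht : 0 ≤ t) (n : ℕ) :
    ∫⁻ w in Set.Icc 0 t, ENNReal.ofReal c * ENNReal.ofReal ((c * w) ^ n / n.factorial) =
      ENNReal.ofReal ((c * t) ^ (n + 1) / (n + 1).factorial) := by
  simp_rw [← ENNReal.ofReal_mul hc]
  rw [← ofReal_integral_eq_lintegral_ofReal
    (Continuous.integrableOn_Icc (by fun_prop))
    ((ae_restrict_iff' measurableSet_Icc).2 (.of_forall fun w hw => by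
      have := hw.1; positivity)),
    integral_Icc_eq_integral_Ioc, ← intervalIntegral.integral_of_le ht]
  congr 1
  simp only [mul_pow, intervalIntegral.integral_const_mul, intervalIntegral.integral_div,
    integral_pow, Nat.factorial_succ]
  push_cast
  field_simp
  ring_nf

/-- Hölder comparison of `P_{n,rt}` with `P_{n,t}` for `r ≥ 1`. -/
theorem lintegral_jumpMarginalN_mul_le [IsMarkovKernel k] [IsProbabilityMeasure P0]
    (hl : Measurable l) (hl0 : ∀ x, 0 ≤ l x) {lbar : ℝ} (hlbar : ∀ x, l x ≤ lbar)
    (hlbar0 : 0 ≤ lbar) {p q r : ℝ} (hpq : p.HolderConjugate q) (hr : 1 ≤ r) (n : ℕ)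
    {t : ℝ} (ht : 0 ≤ t) {f : E → ℝ≥0∞} (hf : Measurable f) :
    ∫⁻ x, f x ∂(jumpMarginalN l k P0 n (r * t)) ≤
      (∫⁻ x, f x ^ p ∂(jumpMarginalN l k P0 n t)) ^ (1 / p) *
        ENNReal.ofReal ((r ^ q * lbar * t) ^ n / n.factorial) ^ (1 / q) := by
  have hp := hpq.pos
  have hq := hpq.symm.pos
  have hr0 : 0 < r := by linarith
  have hpq1 : 1 / p + 1 / q = 1 := by simpa using hpq.inv_add_inv_eq_one
  induction n generalizing t f with
  | zero =>
    rw [lintegral_jumpMarginalN_zero hl _ hf, lintegral_jumpMarginalN_zero hl _ (hf.pow_const p)]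
    simpa using lintegral_exp_mul_le hpq hr ht hl hl0 P0 hf
  | succ n ih =>
    rw [lintegral_jumpMarginalN_succ hl _ _ hf, lintegral_jumpMarginalN_succ hl _ _ (hf.pow_const p),
      setLIntegral_Icc_zero_mul hr0,
      ← setLIntegral_Icc_pow_div_factorial (by positivity) ht n]
    have hmeas := measurable_lintegral_jumpMarginalN (k := k) (P0 := P0) hl n (β := ℝ) (h := id)
      (measurable_jump_integrand (k := k) hl (g := fun q : ℝ × E => f q.2 ^ p)
        (by fun_prop) (τ := fun w => t - w) (by fun_prop)) measurable_id
    refine le_trans ?_ ((ENNReal.lintegral_mul_le_Lp_mul_Lq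
      (volume.restrict (Set.Icc 0 t)) hpq
      (hmeas.pow_const (1 / p)).aemeasurable
      (g := fun w => (ENNReal.ofReal (r ^ q * lbar) *
        ENNReal.ofReal ((r ^ q * lbar * w) ^ n / n.factorial)) ^ (1 / q))
      (Measurable.aemeasurable (by fun_prop))).trans_eq ?_)
    · refine setLIntegral_mono' measurableSet_Icc fun w hw => ?_
      have hkf : Measurable fun x => ENNReal.ofReal (l x) *
          ∫⁻ y, ENNReal.ofReal (Real.exp (-(l y) * (t - w))) * f y ^ p ∂(k x) :=
        (measurable_jump_integrand (k := k) hl (g := fun q : ℝ × E => f q.2 ^ p)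
          (by fun_prop) (τ := fun w => t - w) (by fun_prop)).comp (measurable_prodMk_left (x := w))
      have hstep (x : E) : ENNReal.ofReal (l x) *
            ∫⁻ y, ENNReal.ofReal (Real.exp (-(l y) * (r * t - r * w))) * f y ∂(k x) ≤
          ENNReal.ofReal lbar ^ (1 / q) * (ENNReal.ofReal (l x) *
            ∫⁻ y, ENNReal.ofReal (Real.exp (-(l y) * (t - w))) * f y ^ p ∂(k x)) ^ (1 / p) := by
        have h := lintegral_exp_mul_le hpq hr (sub_nonneg.2 hw.2) hl hl0 (k x) hf
        simp only [mul_sub r] at h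
        calc _ ≤ ENNReal.ofReal (l x) * _ := by gcongr
          _ = ENNReal.ofReal (l x) ^ (1 / q) * ENNReal.ofReal (l x) ^ (1 / p) * _ := by
            rw [← ENNReal.rpow_add_of_nonneg _ _ (by positivity) (by positivity), add_comm, hpq1,
              ENNReal.rpow_one]
          _ ≤ _ := by
            rw [ENNReal.mul_rpow_of_nonneg _ _ (by positivity), mul_assoc]
            gcongr
            exact hlbar x
      have hih := ih hw.1 (hkf.pow_const (1 / p))
      simp only [← ENNReal.rpow_mul, one_div_mul_cancel hp.ne', ENNReal.rpow_one] at hih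
      have hrq : ENNReal.ofReal (r ^ q * lbar) ^ (1 / q) =
          ENNReal.ofReal r * ENNReal.ofReal lbar ^ (1 / q) := by
        rw [ENNReal.ofReal_mul (by positivity), ENNReal.mul_rpow_of_nonneg _ _ (by positivity),
          ← ENNReal.ofReal_rpow_of_nonneg hr0.le hq.le, ← ENNReal.rpow_mul,
          mul_one_div_cancel hq.ne', ENNReal.rpow_one]
      refine (mul_le_mul' le_rfl (((lintegral_mono hstep).trans_eq
        (lintegral_const_mul _ (hkf.pow_const _))).trans (mul_le_mul' le_rfl hih))).trans_eq ?_
      simp only [Pi.mul_apply, id]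
      rw [ENNReal.mul_rpow_of_nonneg _ _ (by positivity : (0:ℝ) ≤ 1 / q), hrq]
      ring
    · simp only [← ENNReal.rpow_mul, one_div_mul_cancel hp.ne', one_div_mul_cancel hq.ne',
        ENNReal.rpow_one, id]

theorem ENNReal.tsum_mul_le_Lp_mul_Lq {p q : ℝ} (hpq : p.HolderConjugate q) (a b : ℕ → ℝ≥0∞) :
    ∑' n, a n ^ (1 / p) * b n ^ (1 / q) ≤ (∑' n, a n) ^ (1 / p) * (∑' n, b n) ^ (1 / q) := by
  have h := ENNReal.lintegral_mul_le_Lp_mul_Lq Measure.count hpq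
    (f := fun n => a n ^ (1 / p)) (g := fun n => b n ^ (1 / q)) (by fun_prop) (by fun_prop)
  simpa only [lintegral_count, Pi.mul_apply, ← ENNReal.rpow_mul,
    one_div_mul_cancel hpq.pos.ne', one_div_mul_cancel hpq.symm.pos.ne', ENNReal.rpow_one] using h

theorem tsum_ofReal_pow_div_factorial {x : ℝ} (hx : 0 ≤ x) :
    ∑' n : ℕ, ENNReal.ofReal (x ^ n / n.factorial) = ENNReal.ofReal (Real.exp x) := by
  have h := NormedSpace.expSeries_div_hasSum_exp x
  rw [← ENNReal.ofReal_tsum_of_nonneg (fun n => by positivity) h.summable, h.tsum_eq,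
    Real.exp_eq_exp_ℝ]

end

/-- comparison of integrals against `P_s` and `P_t`:
`∫|f| dP_s ≤ 1_{s≤t} e^{λ̄(t-s)} ∫|f| dP_t
  + 1_{s>t} e^{ηλ̄s(s/t)^{1/η}/(1+η)} (∫|f|^{1+η} dP_t)^{1/(1+η)}`. -/
theorem stmt13 {d : ℕ}
    (l : EuclideanSpace ℝ (Fin d) → ℝ)
    (k : Kernel (EuclideanSpace ℝ (Fin d)) (EuclideanSpace ℝ (Fin d))) [IsMarkovKernel k]
    (hl : Measurable l) (hl0 : ∀ x, 0 ≤ l x)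
    (lbar : ℝ) (hlbar : ∀ x, l x ≤ lbar)
    (hnofake : ∀ x, ENNReal.ofReal (l x) * k x {x} = 0)
    (P0 : Measure (EuclideanSpace ℝ (Fin d))) [IsProbabilityMeasure P0]
    (t s : ℝ) (ht : 0 < t) (hs : 0 ≤ s)
    (f : EuclideanSpace ℝ (Fin d) → ℝ) (hf : Measurable f)
    (η : ℝ) (hη : 0 < η) :
    ∫⁻ x, ENNReal.ofReal |f x| ∂(jumpMarginal l k P0 s)
      ≤ if s ≤ t then
          ENNReal.ofReal (Real.exp (lbar * (t - s))) *
            ∫⁻ x, ENNReal.ofReal |f x| ∂(jumpMarginal l k P0 t)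
        else
          ENNReal.ofReal (Real.exp (η * lbar * s * (s / t) ^ (1 / η) / (1 + η))) *
            (∫⁻ x, ENNReal.ofReal (|f x| ^ (1 + η)) ∂(jumpMarginal l k P0 t)) ^ (1 / (1 + η)) := by
  have hfa : Measurable fun x => ENNReal.ofReal |f x| := by fun_prop
  simp only [jumpMarginal, lintegral_sum_measure]
  split_ifs with hst
  · rw [← ENNReal.tsum_mul_left]
    exact ENNReal.tsum_le_tsum fun n => lintegral_jumpMarginalN_le_of_le hl hlbar n hst hfa
  · push Not at hst
    have hlbar0 : 0 ≤ lbar := (hl0 0).trans (hlbar 0)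
    have hpq : (1 + η).HolderConjugate ((1 + η) / η) := by
      rw [Real.holderConjugate_iff]
      exact ⟨by linarith, by field_simp⟩
    have hr : 1 ≤ s / t := (one_le_div ht).2 hst.le
    have hr0 : 0 < s / t := by linarith
    have hst' : s = s / t * t := by field_simp
    have hrT : (s / t) ^ ((1 + η) / η) * lbar * t = lbar * s * (s / t) ^ (1 / η) := by
      rw [show (1 + η) / η = 1 / η + 1 by field_simp, Real.rpow_add_one hr0.ne']
      field_simp
    have key (n : ℕ) := lintegral_jumpMarginalN_mul_le (k := k) (P0 := P0) hl hl0 hlbar hlbar0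
      hpq hr n ht.le hfa
    rw [← hst', hrT] at key
    simp only [ENNReal.ofReal_rpow_of_nonneg (abs_nonneg _) hpq.pos.le] at key
    refine (ENNReal.tsum_le_tsum key).trans ((ENNReal.tsum_mul_le_Lp_mul_Lq hpq _ _).trans_eq ?_)
    rw [tsum_ofReal_pow_div_factorial (by positivity),
      ENNReal.ofReal_rpow_of_nonneg (Real.exp_nonneg _) (one_div_nonneg.2 hpq.symm.pos.le),
      ← Real.exp_mul, mul_comm]
    congr 3
    field_simp
end

section
/- Consider a pure jump Markov process on ℝ^d with data (λ,k,P₀) and time marginals {P_t}, where λ̄:=sup_x λ(x)<∞. Let α≥1 and assume k̄_α := max( ∫|x|^α P₀(dx), sup_x ∫ |y−x|^α k(x,dy) ) < ∞. Then for every t≥0, ∫|x|^α P_t(dx) ≤ k̄_α ( Σ_{n=0}^{⌈α⌉−1} ((n+1)^α/n!) (λ̄t)ⁿ + ((⌈α⌉+1)^α/⌈α⌉!) (λ̄t)^{⌈α⌉} e^{λ̄t} ), where ⌈α⌉ denotes the integer with α ≤ ⌈α⌉ < α+1. -/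
open MeasureTheory ProbabilityTheory
open scoped ENNReal

theorem rpow_add_le_weighted {a b c α : ℝ} (ha : 0 ≤ a) (hb : 0 ≤ b) (hc : 0 < c)
    (hα : 1 ≤ α) :
    (a + b) ^ α ≤ c / (c + 1) * ((c + 1) / c) ^ α * a ^ α
      + 1 / (c + 1) * (c + 1) ^ α * b ^ α := by
  have hx : (c + 1) / c * a ∈ Set.Ici (0 : ℝ) := Set.mem_Ici.2 (by positivity)
  have hy : (c + 1) * b ∈ Set.Ici (0 : ℝ) := Set.mem_Ici.2 (by positivity)
  have hw : c / (c + 1) + 1 / (c + 1) = 1 := by field_simp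
  have h := (convexOn_rpow hα).right hx hy (by positivity) (by positivity) hw
  simp only [smul_eq_mul] at h
  rw [Real.mul_rpow (by positivity) ha, Real.mul_rpow (by positivity) hb] at h
  have e : c / (c + 1) * ((c + 1) / c * a) + 1 / (c + 1) * ((c + 1) * b) = a + b := by
    field_simp
  rw [e] at h
  linarith

theorem weighted_rpow_sum {c α : ℝ} (hc : 0 < c) :
    c / (c + 1) * ((c + 1) / c) ^ α * c ^ α + 1 / (c + 1) * (c + 1) ^ α = (c + 1) ^ α := by
  have h : ((c + 1) / c) ^ α * c ^ α = (c + 1) ^ α := by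
    rw [← Real.mul_rpow (by positivity) hc.le]
    congr 1
    field_simp
  rw [mul_assoc, h]
  field_simp

theorem div_pow_le_choose_add (m j : ℕ) :
    (((m + j : ℕ) + 1 : ℝ) / (m + 1)) ^ m ≤ ((m + j).choose m : ℝ) := by
  induction j with
  | zero =>
    have : (m : ℝ) + 1 ≠ 0 := by positivity
    simp [div_self this]
  | succ j ih =>
    have hchoose : ((m + (j + 1)).choose m : ℝ) * (j + 1) = (m + j).choose m * (m + j + 1) := by
      have h := Nat.choose_mul_succ_eq (m + j) m
      have e : m + j + 1 - m = j + 1 := by omega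
      rw [e] at h
      exact_mod_cast h.symm
    have hbern : (j + 1 : ℝ) / (m + j + 1) ≤ ((m + j + 1 : ℝ) / (m + j + 2)) ^ m := by
      have h := one_add_mul_le_pow (a := -(1 / (m + j + 2 : ℝ))) (by
        have : (1 : ℝ) / (m + j + 2) ≤ 1 := by
          rw [div_le_one (by positivity)]
          linarith [(Nat.cast_nonneg m : (0 : ℝ) ≤ m), (Nat.cast_nonneg j : (0 : ℝ) ≤ j)]
        linarith) m
      have e : 1 + -(1 / (m + j + 2 : ℝ)) = (m + j + 1 : ℝ) / (m + j + 2) := by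
        field_simp
        ring
      rw [e] at h
      refine le_trans ?_ h
      have h1 : (m : ℝ) / (m + j + 2) ≤ m / (m + j + 1) := by
        gcongr
        linarith
      have h2 : (j + 1 : ℝ) / (m + j + 1) = 1 - m / (m + j + 1) := by
        field_simp
        ring
      rw [h2, mul_neg, mul_one_div]
      linarith
    have hsplit : (((m + (j + 1) : ℕ) + 1 : ℝ) / (m + 1)) ^ m
        * ((m + j + 1 : ℝ) / (m + j + 2)) ^ m = (((m + j : ℕ) + 1 : ℝ) / (m + 1)) ^ m := by
      rw [← mul_pow]
      congr 1
      push_cast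
      field_simp
      ring
    have hprod := (mul_le_mul_of_nonneg_left hbern (by positivity)).trans (hsplit.le.trans ih)
    rw [mul_div_assoc', div_le_iff₀ (by positivity), ← hchoose] at hprod
    exact le_of_mul_le_mul_right hprod (by positivity)

theorem rpow_div_factorial_le {α : ℝ} {m : ℕ} (hm : α ≤ m) (j : ℕ) :
    ((m + j : ℕ) + 1 : ℝ) ^ α / (m + j).factorial
      ≤ ((m : ℝ) + 1) ^ α / m.factorial * (1 / j.factorial) := by
  have hratio : (((m + j : ℕ) + 1 : ℝ) / (m + 1)) ^ α ≤ ((m + j).choose m : ℝ) := by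
    refine le_trans ?_ (div_pow_le_choose_add m j)
    rw [← Real.rpow_natCast]
    refine Real.rpow_le_rpow_of_exponent_le ?_ hm
    rw [le_div_iff₀ (by positivity)]
    push_cast
    linarith [(Nat.cast_nonneg j : (0 : ℝ) ≤ j)]
  rw [Real.div_rpow (by positivity) (by positivity), div_le_iff₀ (by positivity)] at hratio
  have hfac : ((m + j).choose m : ℝ) * (m.factorial * j.factorial) = (m + j).factorial := by
    have h := Nat.add_choose_mul_factorial_mul_factorial m j
    rw [← Nat.choose_symm_add] at h
    rw [← mul_assoc]
    exact_mod_cast h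
  rw [div_mul_div_comm, mul_one, div_le_div_iff₀ (by positivity) (by positivity), ← hfac]
  calc ((m + j : ℕ) + 1 : ℝ) ^ α * (m.factorial * j.factorial)
      ≤ ((m + j).choose m * ((m : ℝ) + 1) ^ α) * (m.factorial * j.factorial) := by gcongr
    _ = _ := by ring

theorem tsum_ofReal_rpow_div_factorial_le {α x : ℝ} (hx : 0 ≤ x) {m : ℕ} (hm : α ≤ m) :
    ∑' n : ℕ, ENNReal.ofReal (((n : ℝ) + 1) ^ α / n.factorial * x ^ n)
      ≤ ENNReal.ofReal ((∑ n ∈ Finset.range m, ((n : ℝ) + 1) ^ α / n.factorial * x ^ n)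
          + ((m : ℝ) + 1) ^ α / m.factorial * x ^ m * Real.exp x) := by
  rw [ENNReal.ofReal_add (Finset.sum_nonneg fun n _ => by positivity) (by positivity),
    ENNReal.ofReal_sum_of_nonneg fun n _ => by positivity,
    ← ENNReal.summable.sum_add_tsum_nat_add' (k := m)]
  gcongr
  have hexp : HasSum (fun j : ℕ => ((m : ℝ) + 1) ^ α / m.factorial * x ^ m
      * (x ^ j / j.factorial)) (((m : ℝ) + 1) ^ α / m.factorial * x ^ m * Real.exp x) := by
    rw [Real.exp_eq_exp_ℝ]
    exact (NormedSpace.expSeries_div_hasSum_exp x).mul_left _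
  rw [← hexp.tsum_eq, ENNReal.ofReal_tsum_of_nonneg (fun j => by positivity) hexp.summable]
  refine ENNReal.tsum_le_tsum fun j => ENNReal.ofReal_le_ofReal ?_
  rw [add_comm j m]
  calc ((m + j : ℕ) + 1 : ℝ) ^ α / (m + j).factorial * x ^ (m + j)
      ≤ ((m : ℝ) + 1) ^ α / m.factorial * (1 / j.factorial) * x ^ (m + j) := by
        gcongr
        exact rpow_div_factorial_le hm j
    _ = _ := by
        rw [pow_add]
        ring

section Measure

variable {E F : Type*} [MeasurableSpace E] [MeasurableSpace F]

theorem lintegral_bind_le (μ : Measure E) (f : E → Measure F) {g : F → ℝ≥0∞}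
    (hg : Measurable g) : ∫⁻ y, g y ∂(μ.bind f) ≤ ∫⁻ x, ∫⁻ y, g y ∂(f x) ∂μ := by
  by_cases hf : AEMeasurable f μ
  · rw [Measure.lintegral_bind hf hg.aemeasurable]
  · simp [Measure.bind, Measure.map_of_not_aemeasurable hf]

theorem lintegral_withDensity_le_const_mul (μ : Measure E) {f : E → ℝ≥0∞} {c : ℝ≥0∞}
    (hf : ∀ x, f x ≤ c) (g : E → ℝ≥0∞) :
    ∫⁻ x, g x ∂(μ.withDensity f) ≤ c * ∫⁻ x, g x ∂μ := by
  have h : μ.withDensity f ≤ c • μ := by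
    rw [← withDensity_const]
    exact withDensity_mono (Filter.Eventually.of_forall hf)
  exact (lintegral_mono' h le_rfl).trans_eq (lintegral_smul_measure ..)

theorem ofReal_exp_neg_mul_le_one {a t : ℝ} (ha : 0 ≤ a) (ht : 0 ≤ t) :
    ENNReal.ofReal (Real.exp (-a * t)) ≤ 1 := by
  rw [ENNReal.ofReal_le_one, Real.exp_le_one_iff]
  nlinarith [mul_nonneg ha ht]

theorem setLIntegral_Icc_ofReal_mul_pow_div_factorial {c t : ℝ} (hc : 0 ≤ c) (ht : 0 ≤ t)
    (n : ℕ) :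
    ∫⁻ s in Set.Icc 0 t, ENNReal.ofReal c * ENNReal.ofReal ((c * s) ^ n / n.factorial)
      = ENNReal.ofReal ((c * t) ^ (n + 1) / (n + 1).factorial) := by
  have hcont : Continuous fun s : ℝ => c * ((c * s) ^ n / n.factorial) := by fun_prop
  simp_rw [← ENNReal.ofReal_mul hc]
  rw [← ofReal_integral_eq_lintegral_ofReal (hcont.integrableOn_Icc)
    ((ae_restrict_mem measurableSet_Icc).mono fun s hs => by
      have := hs.1
      positivity),
    integral_Icc_eq_integral_Ioc, ← intervalIntegral.integral_of_le ht]
  congr 1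
  have e : (fun s : ℝ => c * ((c * s) ^ n / n.factorial))
      = fun s => c ^ (n + 1) / n.factorial * s ^ n := by
    funext s
    rw [mul_pow]
    ring
  rw [e, intervalIntegral.integral_const_mul, integral_pow, Nat.factorial_succ]
  push_cast
  field_simp
  simp [mul_pow]

theorem lintegral_jumpMarginalN_succ_le {l : E → ℝ} (k : Kernel E E) (P0 : Measure E)
    (hl0 : ∀ x, 0 ≤ l x) {c : ℝ} (hlc : ∀ x, l x ≤ c) {g : E → ℝ≥0∞} (hg : Measurable g)
    (n : ℕ) (t : ℝ) :
    ∫⁻ x, g x ∂(jumpMarginalN l k P0 (n + 1) t)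
      ≤ ∫⁻ s in Set.Icc 0 t,
          ENNReal.ofReal c * ∫⁻ x, ∫⁻ y, g y ∂(k x) ∂(jumpMarginalN l k P0 n s) := by
  rw [jumpMarginalN]
  refine (lintegral_bind_le _ _ hg).trans
    (lintegral_mono_ae ((ae_restrict_mem measurableSet_Icc).mono fun s hs => ?_))
  refine (lintegral_bind_le _ _ hg).trans ((lintegral_mono fun x => ?_).trans
    (lintegral_withDensity_le_const_mul _ (fun x => ENNReal.ofReal_le_ofReal (hlc x)) _))
  exact (lintegral_withDensity_le_const_mul _
    (fun y => ofReal_exp_neg_mul_le_one (hl0 y) (sub_nonneg.2 hs.2)) _).trans_eq (one_mul _)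

theorem lintegral_jumpMarginalN_zero_le {l : E → ℝ} (k : Kernel E E) (P0 : Measure E)
    (hl0 : ∀ x, 0 ≤ l x) (g : E → ℝ≥0∞) {t : ℝ} (ht : 0 ≤ t) :
    ∫⁻ x, g x ∂(jumpMarginalN l k P0 0 t) ≤ ∫⁻ x, g x ∂P0 := by
  rw [jumpMarginalN]
  exact (lintegral_withDensity_le_const_mul _
    (fun x => ofReal_exp_neg_mul_le_one (hl0 x) ht) _).trans_eq (one_mul _)

theorem jumpMarginalN_univ_le {l : E → ℝ} (k : Kernel E E) [IsMarkovKernel k]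
    (P0 : Measure E) [IsProbabilityMeasure P0] (hl0 : ∀ x, 0 ≤ l x) {c : ℝ} (hc : 0 ≤ c)
    (hlc : ∀ x, l x ≤ c) (n : ℕ) {t : ℝ} (ht : 0 ≤ t) :
    jumpMarginalN l k P0 n t Set.univ ≤ ENNReal.ofReal ((c * t) ^ n / n.factorial) := by
  induction n generalizing t with
  | zero => simpa using lintegral_jumpMarginalN_zero_le k P0 hl0 (fun _ => 1) ht
  | succ n ih =>
    have h := lintegral_jumpMarginalN_succ_le k P0 hl0 hlc
      (measurable_const (a := (1 : ℝ≥0∞))) n t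
    simp only [lintegral_const, measure_univ, mul_one, one_mul] at h
    rw [← setLIntegral_Icc_ofReal_mul_pow_div_factorial hc ht]
    refine h.trans (lintegral_mono_ae ((ae_restrict_mem measurableSet_Icc).mono fun s hs => ?_))
    gcongr
    exact ih hs.1

end Measure

section Moment

variable {E : Type*} [NormedAddCommGroup E] [MeasurableSpace E]

theorem lintegral_norm_rpow_le_of_jump {α : ℝ} (hα : 1 ≤ α) {c : ℝ} (hc : 0 < c) (μ : Measure E)
    [IsProbabilityMeasure μ] (x : E) {K : ℝ≥0∞}
    (h : ∫⁻ y, ENNReal.ofReal (‖y - x‖ ^ α) ∂μ ≤ K) :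
    ∫⁻ y, ENNReal.ofReal (‖y‖ ^ α) ∂μ
      ≤ ENNReal.ofReal (c / (c + 1) * ((c + 1) / c) ^ α) * ENNReal.ofReal (‖x‖ ^ α)
        + ENNReal.ofReal (1 / (c + 1) * (c + 1) ^ α) * K := by
  calc ∫⁻ y, ENNReal.ofReal (‖y‖ ^ α) ∂μ
      ≤ ∫⁻ y, (ENNReal.ofReal (c / (c + 1) * ((c + 1) / c) ^ α) * ENNReal.ofReal (‖x‖ ^ α)
          + ENNReal.ofReal (1 / (c + 1) * (c + 1) ^ α) * ENNReal.ofReal (‖y - x‖ ^ α)) ∂μ := by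
        refine lintegral_mono fun y => ?_
        rw [← ENNReal.ofReal_mul (by positivity), ← ENNReal.ofReal_mul (by positivity),
          ← ENNReal.ofReal_add (by positivity) (by positivity)]
        refine ENNReal.ofReal_le_ofReal (le_trans ?_
          (rpow_add_le_weighted (norm_nonneg x) (norm_nonneg (y - x)) hc hα))
        gcongr
        simpa using norm_add_le x (y - x)
    _ ≤ _ := by
        rw [lintegral_add_left measurable_const, lintegral_const, measure_univ, mul_one,
          lintegral_const_mul' _ _ ENNReal.ofReal_ne_top]
        gcongr

variable [BorelSpace E]

theorem lintegral_norm_rpow_jumpMarginalN_le {l : E → ℝ} (k : Kernel E E) [IsMarkovKernel k]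
    (P0 : Measure E) [IsProbabilityMeasure P0] (hl0 : ∀ x, 0 ≤ l x) {c : ℝ} (hc : 0 ≤ c)
    (hlc : ∀ x, l x ≤ c) {α : ℝ} (hα : 1 ≤ α) {K : ℝ≥0∞}
    (hK0 : ∫⁻ x, ENNReal.ofReal (‖x‖ ^ α) ∂P0 ≤ K)
    (hK : ∀ x, ∫⁻ y, ENNReal.ofReal (‖y - x‖ ^ α) ∂(k x) ≤ K) (n : ℕ) {t : ℝ} (ht : 0 ≤ t) :
    ∫⁻ x, ENNReal.ofReal (‖x‖ ^ α) ∂(jumpMarginalN l k P0 n t)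
      ≤ ENNReal.ofReal (((n : ℝ) + 1) ^ α) * K * ENNReal.ofReal ((c * t) ^ n / n.factorial) := by
  induction n generalizing t with
  | zero => simpa using (lintegral_jumpMarginalN_zero_le k P0 hl0 _ ht).trans hK0
  | succ n ih =>
    have hmeas : Measurable fun x : E => ENNReal.ofReal (‖x‖ ^ α) := by fun_prop
    have hstep : ∀ s ∈ Set.Icc 0 t,
        ∫⁻ x, ∫⁻ y, ENNReal.ofReal (‖y‖ ^ α) ∂(k x) ∂(jumpMarginalN l k P0 n s)
          ≤ ENNReal.ofReal ((((n + 1 : ℕ) : ℝ) + 1) ^ α) * K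
            * ENNReal.ofReal ((c * s) ^ n / n.factorial) := by
      intro s hs
      have hn : (0 : ℝ) < (n : ℝ) + 1 := by positivity
      refine (lintegral_mono fun x => lintegral_norm_rpow_le_of_jump hα hn (k x) x (hK x)).trans ?_
      rw [lintegral_add_right _ measurable_const, lintegral_const,
        lintegral_const_mul' _ _ ENNReal.ofReal_ne_top]
      refine (add_le_add (mul_le_mul_right (ih hs.1) _) (mul_le_mul_right
        (jumpMarginalN_univ_le k P0 hl0 hc hlc n hs.1) _)).trans_eq ?_
      have hsum := congrArg ENNReal.ofReal (weighted_rpow_sum (α := α) hn)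
      rw [ENNReal.ofReal_add (by positivity) (by positivity),
        ENNReal.ofReal_mul (q := ((n : ℝ) + 1) ^ α) (by positivity)] at hsum
      rw [Nat.cast_succ, ← hsum]
      ring
    calc ∫⁻ x, ENNReal.ofReal (‖x‖ ^ α) ∂(jumpMarginalN l k P0 (n + 1) t)
        ≤ ∫⁻ s in Set.Icc 0 t, ENNReal.ofReal ((((n + 1 : ℕ) : ℝ) + 1) ^ α) * K
            * (ENNReal.ofReal c * ENNReal.ofReal ((c * s) ^ n / n.factorial)) := by
          refine (lintegral_jumpMarginalN_succ_le k P0 hl0 hlc hmeas n t).trans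
            (lintegral_mono_ae ((ae_restrict_mem measurableSet_Icc).mono fun s hs => ?_))
          rw [mul_left_comm]
          exact mul_le_mul_right (hstep s hs) _
      _ = _ := by
          rw [lintegral_const_mul _ (by fun_prop),
            setLIntegral_Icc_ofReal_mul_pow_div_factorial hc ht]

end Moment

/-- moment bound for the marginals of a pure jump process: if the initial
`α`-moment and the `α`-moments of the jump sizes are bounded by `k̄_α`, then
`∫ |x|^α P_t(dx) ≤ k̄_α (Σ_{n<⌈α⌉} ((n+1)^α/n!)(λ̄t)ⁿ + ((⌈α⌉+1)^α/⌈α⌉!)(λ̄t)^{⌈α⌉} e^{λ̄t})`. -/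
theorem stmt15 {d : ℕ}
    (l : EuclideanSpace ℝ (Fin d) → ℝ)
    (k : Kernel (EuclideanSpace ℝ (Fin d)) (EuclideanSpace ℝ (Fin d))) [IsMarkovKernel k]
    (hl : Measurable l) (hl0 : ∀ x, 0 ≤ l x)
    (lbar : ℝ) (hlbar : ∀ x, l x ≤ lbar)
    (hnofake : ∀ x, ENNReal.ofReal (l x) * k x {x} = 0)
    (P0 : Measure (EuclideanSpace ℝ (Fin d))) [IsProbabilityMeasure P0]
    (α : ℝ) (hα : 1 ≤ α) (kbar : ℝ)
    (hk0 : ∫⁻ x, ENNReal.ofReal (‖x‖ ^ α) ∂P0 ≤ ENNReal.ofReal kbar)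
    (hkjump : ∀ x, ∫⁻ y, ENNReal.ofReal (‖y - x‖ ^ α) ∂(k x) ≤ ENNReal.ofReal kbar)
    (t : ℝ) (ht : 0 ≤ t) :
    ∫⁻ x, ENNReal.ofReal (‖x‖ ^ α) ∂(jumpMarginal l k P0 t)
      ≤ ENNReal.ofReal (kbar *
          ((∑ n ∈ Finset.range ⌈α⌉₊, ((n : ℝ) + 1) ^ α / n.factorial * (lbar * t) ^ n)
            + ((⌈α⌉₊ : ℝ) + 1) ^ α / (⌈α⌉₊).factorial * (lbar * t) ^ ⌈α⌉₊
                * Real.exp (lbar * t))) := by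
  have hc : 0 ≤ lbar := (hl0 0).trans (hlbar 0)
  have hx : 0 ≤ lbar * t := mul_nonneg hc ht
  rw [jumpMarginal, lintegral_sum_measure, ENNReal.ofReal_mul' (by positivity)]
  calc ∑' n, ∫⁻ x, ENNReal.ofReal (‖x‖ ^ α) ∂(jumpMarginalN l k P0 n t)
      ≤ ∑' n : ℕ, ENNReal.ofReal kbar
          * ENNReal.ofReal (((n : ℝ) + 1) ^ α / n.factorial * (lbar * t) ^ n) := by
        refine ENNReal.tsum_le_tsum fun n => (lintegral_norm_rpow_jumpMarginalN_le k P0 hl0 hc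
          hlbar hα hk0 hkjump n ht).trans_eq ?_
        rw [mul_comm (ENNReal.ofReal _) (ENNReal.ofReal kbar), mul_assoc,
          ← ENNReal.ofReal_mul (by positivity)]
        congr 2
        ring
    _ ≤ _ := by
        rw [ENNReal.tsum_mul_left]
        gcongr
        exact tsum_ofReal_rpow_div_factorial_le hx (Nat.le_ceil α)
end
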